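/- Let Φ be a Young function satisfying the Δ2-condition. A finite-valued monetary utility function u : L_{Φ*} → ℝ is τ(L_{Φ*},L_Φ)-continuous if and only if it is continuous from below: ξ_n ↑ ξ in L_{Φ*} implies u(ξ) = lim_n u(ξ_n). -/

import Mathlib

open MeasureTheory Filter Topology Set
open scoped ENNReal

noncomputable section

namespace OrliczPaper

variable {Ω : Type*} [MeasurableSpace Ω]

/-- A (finite, coercive) Young function: an even convex function with `Φ 0 = 0`
and `Φ x / x → ∞` as `x → ∞`. -/
structure IsYoung (Φ : ℝ → ℝ) : Prop where
  even : ∀ x, Φ (-x) = Φ x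
  convexOn : ConvexOn ℝ Set.univ Φ
  map_zero : Φ 0 = 0
  coercive : Tendsto (fun x => Φ x / x) atTop atTop

/-- The Δ₂-condition: `limsup_{x→∞} Φ(2x)/Φ(x) < ∞`, i.e. `Φ(2x) ≤ C Φ(x)`
for all large `x`. -/
def Delta2 (Φ : ℝ → ℝ) : Prop :=
  ∃ C x₀ : ℝ, ∀ x ≥ x₀, Φ (2 * x) ≤ C * Φ x

/-- The conjugate Young function `Φ*(y) = sup_x (x y − Φ x)`. -/
def conj (Φ : ℝ → ℝ) (y : ℝ) : ℝ := ⨆ x : ℝ, x * y - Φ x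

variable (P : Measure Ω)

/-- Membership in the Orlicz space `L_Φ`: a measurable function with
`E[Φ(l ξ)] < ∞` for some `l > 0`. -/
def MemOrlicz (Φ : ℝ → ℝ) (f : Ω → ℝ) : Prop :=
  Measurable f ∧ ∃ l : ℝ, 0 < l ∧ ∫⁻ ω, ENNReal.ofReal (Φ (l * f ω)) ∂P < ⊤

/-- The Orlicz space `L_Φ`, as a set of (everywhere defined) measurable functions. -/
def Orlicz (Φ : ℝ → ℝ) : Set (Ω → ℝ) := {f | MemOrlicz P Φ f}

/-- The Luxemburg norm `‖f‖_Φ = inf {l > 0 : E[Φ(f/l)] ≤ 1}`. -/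
def luxNorm (Φ : ℝ → ℝ) (f : Ω → ℝ) : ℝ :=
  sInf {l : ℝ | 0 < l ∧ ∫⁻ ω, ENNReal.ofReal (Φ (f ω / l)) ∂P ≤ 1}

/-- The Orlicz (dual) norm `‖f‖_{(Φ*)} = sup {E[g f] : E[Φ(g)] ≤ 1}`
(the Young function `Φ` here is the one of the *predual*). -/
def orliczNorm (Φ : ℝ → ℝ) (f : Ω → ℝ) : ℝ :=
  sSup {r : ℝ | ∃ g : Ω → ℝ, Measurable g ∧
    (∫⁻ ω, ENNReal.ofReal (Φ (g ω)) ∂P) ≤ 1 ∧ r = ∫ ω, g ω * f ω ∂P}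

/-- The bilinear pairing `⟨f, g⟩ = E[f g]`. -/
def pairing (f g : Ω → ℝ) : ℝ := ∫ ω, f ω * g ω ∂P

/-- The weak topology `σ(E, F)` on `E` induced by the pairing with `F`. -/
def weakT (E F : Set (Ω → ℝ)) : TopologicalSpace E :=
  TopologicalSpace.induced
    (fun ξ : E => fun η : F => pairing P (ξ : Ω → ℝ) (η : Ω → ℝ)) inferInstance

/-- The absolutely convex (convex and balanced) `σ(F,E)`-compact subsets of `F`. -/
def dualSets (E F : Set (Ω → ℝ)) : Set (Set F) :=
  {A | Convex ℝ (Subtype.val '' A) ∧ Balanced ℝ (Subtype.val '' A) ∧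
    @IsCompact _ (weakT P F E) A}

/-- The Mackey topology `τ(E, F)`: the topology on `E` of uniform convergence on
absolutely convex `σ(F,E)`-compact subsets of `F`. -/
def mackeyT (E F : Set (Ω → ℝ)) : TopologicalSpace E :=
  TopologicalSpace.induced
    (fun ξ : E => UniformOnFun.ofFun (dualSets P E F)
      (fun η : F => pairing P (ξ : Ω → ℝ) (η : Ω → ℝ)))
    inferInstance

/-- A distance generating the topology of convergence in `P`-probability. -/
def probDist (f g : Ω → ℝ) : ℝ := ∫ ω, min |f ω - g ω| 1 ∂P

/-- The topology of convergence in probability, restricted to `E ⊆ L₀`. -/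
def probT (E : Set (Ω → ℝ)) : TopologicalSpace E :=
  TopologicalSpace.generateFrom
    {U | ∃ f : E, ∃ ε : ℝ, 0 < ε ∧ U = {g : E | probDist P (f : Ω → ℝ) (g : Ω → ℝ) < ε}}

/-- `L_∞`: essentially bounded measurable functions. -/
def Linf : Set (Ω → ℝ) := {f | Measurable f ∧ ∃ C : ℝ, ∀ᵐ ω ∂P, |f ω| ≤ C}

/-- `L_1`: integrable measurable functions. -/
def L1 : Set (Ω → ℝ) := {f | Measurable f ∧ Integrable f P}

/-- The essential supremum norm. -/
def linfNorm (f : Ω → ℝ) : ℝ := sInf {C : ℝ | 0 ≤ C ∧ ∀ᵐ ω ∂P, |f ω| ≤ C}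

/-- Uniform integrability of a set of functions:
`sup_{f ∈ A} E[|f| 1_{|f| > N}] → 0`. -/
def UnifInt (A : Set (Ω → ℝ)) : Prop :=
  Tendsto (fun N : ℕ => ⨆ f ∈ A, ∫⁻ ω in {ω | (N : ℝ) < |f ω|}, ENNReal.ofReal |f ω| ∂P)
    atTop (𝓝 0)

/-- Uniform integrability of a sequence of functions. -/
def UnifIntSeq (g : ℕ → Ω → ℝ) : Prop :=
  Tendsto (fun N : ℕ => ⨆ n, ∫⁻ ω in {ω | (N : ℝ) < |g n ω|}, ENNReal.ofReal |g n ω| ∂P)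
    atTop (𝓝 0)

/-- The Cesàro means of a sequence of functions: `cesaro ξ N` is the average of
`ξ 0, …, ξ N`. -/
def cesaro (ξ : ℕ → Ω → ℝ) (N : ℕ) : Ω → ℝ :=
  fun ω => (∑ i ∈ Finset.range (N + 1), ξ i ω) / (N + 1)

/-- `sup_n |ξ n| ∈ L_Φ` (order boundedness of the sequence `ξ` in `L_Φ`). -/
def supMem (Φ : ℝ → ℝ) (ξ : ℕ → Ω → ℝ) : Prop :=
  (∀ᵐ ω ∂P, BddAbove (Set.range fun n => |ξ n ω|)) ∧
    MemOrlicz P Φ (fun ω => ⨆ n, |ξ n ω|)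

/-- `ξb` is a sequence of forward convex combinations of `ξ`:
`ξb n ∈ conv (ξ k ; k ≥ n)`. -/
def FwdConvComb (ξ ξb : ℕ → Ω → ℝ) : Prop :=
  ∀ n, ξb n ∈ convexHull ℝ {g : Ω → ℝ | ∃ k ≥ n, g = ξ k}

/-- The left derivative of a convex function. -/
def leftDeriv (Φ : ℝ → ℝ) (y : ℝ) : ℝ :=
  ⨆ h : {h : ℝ // 0 < h}, (Φ y - Φ (y - (h : ℝ))) / (h : ℝ)

/-- `p_Φ(x) = sup_{y > x} y Φ'(y) / Φ(y)`. -/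
def pPhiAt (Φ : ℝ → ℝ) (x : ℝ) : ℝ≥0∞ :=
  ⨆ y : {y : ℝ // x < y}, ENNReal.ofReal ((y : ℝ) * leftDeriv Φ (y : ℝ) / Φ (y : ℝ))

/-- `p_Φ = inf_{x ≥ 0} p_Φ(x)`. -/
def pPhi (Φ : ℝ → ℝ) : ℝ≥0∞ := ⨅ x : {x : ℝ // 0 ≤ x}, pPhiAt Φ x

/-- `q_Φ = p_Φ / (p_Φ − 1)` (with `1/0 = ∞`). -/
def qPhi (Φ : ℝ → ℝ) : ℝ≥0∞ := pPhi Φ / (pPhi Φ - 1)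

end OrliczPaper

namespace OrliczPaper

/-- An even convex real function vanishing at the origin. -/
structure EvenConvex (F : ℝ → ℝ) : Prop where
  even : ∀ x, F (-x) = F x
  convexOn : ConvexOn ℝ Set.univ F
  map_zero : F 0 = 0

theorem IsYoung.evenConvex {Φ : ℝ → ℝ} (h : IsYoung Φ) : EvenConvex Φ :=
  ⟨h.even, h.convexOn, h.map_zero⟩

namespace EvenConvex

variable {F : ℝ → ℝ}

theorem map_mul_le (h : EvenConvex F) {t : ℝ} (ht₀ : 0 ≤ t) (ht₁ : t ≤ 1) (x : ℝ) :
    F (t * x) ≤ t * F x := by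
  have := h.convexOn.2 (mem_univ x) (mem_univ 0) ht₀ (sub_nonneg.2 ht₁) (by ring)
  simpa [h.map_zero] using this

theorem nonneg (h : EvenConvex F) (x : ℝ) : 0 ≤ F x := by
  have := h.convexOn.2 (mem_univ x) (mem_univ (-x)) (half_pos one_pos).le
    (half_pos one_pos).le (add_halves 1)
  simp [h.even, h.map_zero] at this
  linarith

theorem map_abs (h : EvenConvex F) (x : ℝ) : F |x| = F x := by
  rcases abs_choice x with hx | hx <;> simp [hx, h.even]

theorem mono_abs (h : EvenConvex F) {x y : ℝ} (hxy : |x| ≤ |y|) : F x ≤ F y := by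
  rw [← h.map_abs x, ← h.map_abs y]
  rcases (abs_nonneg y).eq_or_lt with hy | hy
  · have : |x| = |y| := le_antisymm hxy (hy ▸ abs_nonneg x)
    rw [this]
  · have h1 := h.map_mul_le (t := |x| / |y|) (by positivity) ((div_le_one hy).2 hxy) |y|
    rw [div_mul_cancel₀ _ hy.ne'] at h1
    refine h1.trans ?_
    have := (div_le_one hy).2 hxy
    nlinarith [h.nonneg |y|]

theorem continuous (h : EvenConvex F) : Continuous F :=
  continuousOn_univ.1 (h.convexOn.continuousOn isOpen_univ)

theorem measurable (h : EvenConvex F) : Measurable F := h.continuous.measurable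

end EvenConvex

section Conj

variable {Φ : ℝ → ℝ}

theorem IsYoung.bddAbove_conj (h : IsYoung Φ) (y : ℝ) :
    BddAbove (range fun x : ℝ => x * y - Φ x) := by
  obtain ⟨x₀, hx₀⟩ := (eventually_atTop.1 ((tendsto_atTop.1 h.coercive) |y|))
  refine ⟨|x₀| * |y|, ?_⟩
  rintro _ ⟨x, rfl⟩
  have hxy : x * y ≤ |x| * |y| := by rw [← abs_mul]; exact le_abs_self _
  have hΦ := h.evenConvex.nonneg x
  show x * y - Φ x ≤ _
  rcases le_or_gt |x| |x₀| with hx | hx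
  · nlinarith [abs_nonneg y]
  · have hpos : 0 < |x| := (abs_nonneg _).trans_lt hx
    have := hx₀ |x| ((le_abs_self x₀).trans hx.le)
    rw [le_div_iff₀ hpos, h.evenConvex.map_abs] at this
    nlinarith [mul_nonneg (abs_nonneg x₀) (abs_nonneg y)]

theorem IsYoung.young_inequality (h : IsYoung Φ) (x y : ℝ) : x * y ≤ Φ x + conj Φ y := by
  have := le_ciSup (h.bddAbove_conj y) x
  simp only [conj]
  linarith

theorem IsYoung.conj_le {y c : ℝ} (hc : ∀ x, x * y - Φ x ≤ c) : conj Φ y ≤ c :=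
  ciSup_le hc

theorem IsYoung.evenConvex_conj (h : IsYoung Φ) : EvenConvex (conj Φ) where
  even y := by
    have key : ∀ z, conj Φ (-z) ≤ conj Φ z := fun z =>
      IsYoung.conj_le fun x => by
        have := h.young_inequality (-x) z
        rw [h.even] at this
        linarith
    refine le_antisymm (key y) ?_
    simpa using key (-y)
  convexOn := by
    refine ⟨convex_univ, fun x _ y _ a b ha hb hab => IsYoung.conj_le fun z => ?_⟩
    have h1 := mul_le_mul_of_nonneg_left (h.young_inequality z x) ha
    have h2 := mul_le_mul_of_nonneg_left (h.young_inequality z y) hb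
    have h3 : Φ z = a * Φ z + b * Φ z := by rw [← add_mul, hab, one_mul]
    simp only [smul_eq_mul]
    linarith
  map_zero := by
    refine le_antisymm (IsYoung.conj_le fun x => ?_) ?_
    · simpa using h.evenConvex.nonneg x
    · simpa [h.map_zero] using h.young_inequality 0 0

/-- The classical inequality `Φ*(Φ(x)/x) ≤ Φ(x)`. -/
theorem IsYoung.conj_div_le (h : IsYoung Φ) {x : ℝ} (hx : 0 < x) :
    conj Φ (Φ x / x) ≤ Φ x := by
  refine IsYoung.conj_le fun z => ?_
  have hΦx := h.evenConvex.nonneg x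
  have hq : 0 ≤ Φ x / x := by positivity
  have hxx : x * (Φ x / x) = Φ x := by field_simp
  rcases le_or_gt z x with hz | hz
  · nlinarith [h.evenConvex.nonneg z]
  · have hz0 : 0 < z := hx.trans hz
    have := h.evenConvex.map_mul_le (t := x / z) (by positivity) ((div_le_one hz0).2 hz.le) z
    rw [div_mul_cancel₀ _ hz0.ne'] at this
    have h2 : z * (Φ x / x) ≤ Φ z := by
      calc z * (Φ x / x) ≤ z * (x / z * Φ z / x) := by gcongr
        _ = Φ z := by field_simp
    linarith

end Conj

section Space

variable {Ω : Type*} [MeasurableSpace Ω] {P : Measure Ω} {F : ℝ → ℝ} {f g : Ω → ℝ}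

theorem EvenConvex.memOrlicz_add (h : EvenConvex F) (hf : MemOrlicz P F f)
    (hg : MemOrlicz P F g) : MemOrlicz P F (f + g) := by
  obtain ⟨hfm, l, hl, hlf⟩ := hf
  obtain ⟨hgm, m, hm, hmg⟩ := hg
  refine ⟨hfm.add hgm, min l m / 2, by positivity, ?_⟩
  calc ∫⁻ ω, ENNReal.ofReal (F (min l m / 2 * (f + g) ω)) ∂P
      ≤ ∫⁻ ω, (ENNReal.ofReal (F (l * f ω)) + ENNReal.ofReal (F (m * g ω))) ∂P := by
        refine lintegral_mono fun ω => ?_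
        rw [← ENNReal.ofReal_add (h.nonneg _) (h.nonneg _)]
        refine ENNReal.ofReal_le_ofReal ?_
        have hmin : 0 < min l m := lt_min hl hm
        have h1 : F (min l m * f ω) ≤ F (l * f ω) := h.mono_abs (by
          rw [abs_mul, abs_mul, abs_of_pos hmin, abs_of_pos hl]
          gcongr; exact min_le_left _ _)
        have h2 : F (min l m * g ω) ≤ F (m * g ω) := h.mono_abs (by
          rw [abs_mul, abs_mul, abs_of_pos hmin, abs_of_pos hm]
          gcongr; exact min_le_right _ _)
        have h3 := h.convexOn.2 (mem_univ (min l m * f ω)) (mem_univ (min l m * g ω))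
          (half_pos one_pos).le (half_pos one_pos).le (add_halves 1)
        have h4 : min l m / 2 * (f + g) ω
            = (1 / 2 : ℝ) • (min l m * f ω) + (1 / 2 : ℝ) • (min l m * g ω) := by
          simp only [Pi.add_apply, smul_eq_mul]; ring
        rw [h4]
        simp only [smul_eq_mul] at h3 ⊢
        linarith [h.nonneg (l * f ω), h.nonneg (m * g ω)]
    _ = ∫⁻ ω, ENNReal.ofReal (F (l * f ω)) ∂P + ∫⁻ ω, ENNReal.ofReal (F (m * g ω)) ∂P :=
        lintegral_add_left (h.measurable.comp (hfm.const_mul l)).ennreal_ofReal _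
    _ < ⊤ := ENNReal.add_lt_top.2 ⟨hlf, hmg⟩

theorem EvenConvex.memOrlicz_of_abs_le (h : EvenConvex F) (hg : MemOrlicz P F g)
    (hf : Measurable f) (hfg : ∀ᵐ ω ∂P, |f ω| ≤ |g ω|) : MemOrlicz P F f := by
  obtain ⟨-, l, hl, hlg⟩ := hg
  refine ⟨hf, l, hl, (lintegral_mono_ae ?_).trans_lt hlg⟩
  filter_upwards [hfg] with ω hω
  refine ENNReal.ofReal_le_ofReal (h.mono_abs ?_)
  rw [abs_mul, abs_mul]
  gcongr

theorem MemOrlicz.const_smul (hf : MemOrlicz P F f) (c : ℝ) (h : EvenConvex F) :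
    MemOrlicz P F (c • f) := by
  obtain ⟨hfm, l, hl, hlf⟩ := hf
  refine ⟨hfm.const_smul c, l / (|c| + 1), by positivity, (lintegral_mono fun ω => ?_).trans_lt hlf⟩
  refine ENNReal.ofReal_le_ofReal (h.mono_abs ?_)
  have : l / (|c| + 1) * (c • f) ω = (c / (|c| + 1)) * (l * f ω) := by
    simp only [Pi.smul_apply, smul_eq_mul]; ring
  rw [this, abs_mul]
  refine mul_le_of_le_one_left (abs_nonneg _) ?_
  rw [abs_div, abs_of_pos (by positivity : 0 < |c| + 1), div_le_one (by positivity)]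
  linarith

theorem EvenConvex.memOrlicz_const [IsProbabilityMeasure P] (F : ℝ → ℝ) (c : ℝ) :
    MemOrlicz P F fun _ => c :=
  ⟨measurable_const, 1, one_pos, by simp⟩

/-- The Orlicz space as a linear subspace of the space of all functions. -/
def orliczSubmodule (P : Measure Ω) [IsProbabilityMeasure P] {F : ℝ → ℝ} (h : EvenConvex F) :
    Submodule ℝ (Ω → ℝ) where
  carrier := Orlicz P F
  add_mem' := h.memOrlicz_add
  zero_mem' := EvenConvex.memOrlicz_const F 0
  smul_mem' c _ hf := hf.const_smul c h

theorem IsYoung.integrable_mul {Φ : ℝ → ℝ} (h : IsYoung Φ) (hf : MemOrlicz P Φ f)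
    (hg : MemOrlicz P (conj Φ) g) : Integrable (fun ω => f ω * g ω) P := by
  obtain ⟨hfm, l, hl, hlf⟩ := hf
  obtain ⟨hgm, m, hm, hmg⟩ := hg
  have hint : Integrable (fun ω => Φ (l * f ω) + conj Φ (m * g ω)) P := by
    refine Integrable.add ?_ ?_
    · exact ⟨(h.evenConvex.measurable.comp (hfm.const_mul l)).aestronglyMeasurable,
        (hasFiniteIntegral_iff_ofReal (ae_of_all _ fun ω => h.evenConvex.nonneg _)).2 hlf⟩
    · exact ⟨(h.evenConvex_conj.measurable.comp (hgm.const_mul m)).aestronglyMeasurable,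
        (hasFiniteIntegral_iff_ofReal (ae_of_all _ fun ω => h.evenConvex_conj.nonneg _)).2 hmg⟩
  refine (hint.const_mul (l * m)⁻¹).mono' (hfm.mul hgm).aestronglyMeasurable
    (ae_of_all _ fun ω => ?_)
  have hy := h.young_inequality |l * f ω| |m * g ω|
  rw [h.evenConvex.map_abs, h.evenConvex_conj.map_abs, abs_mul, abs_mul, abs_of_pos hl,
    abs_of_pos hm] at hy
  rw [Real.norm_eq_abs, abs_mul, inv_mul_eq_div, le_div_iff₀ (by positivity)]
  linarith

end Space

section KoetheDual

variable {Ω : Type*} [MeasurableSpace Ω] {P : Measure Ω}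

/-- A sequence in the unit ball of an Orlicz space is, up to geometric weights, order bounded. -/
theorem EvenConvex.exists_memOrlicz_forall_le {F : ℝ → ℝ} (h : EvenConvex F) {c : ℝ}
    (hc : ∀ y, y ≤ F y + c) {ξ : ℕ → Ω → ℝ} (hξm : ∀ n, Measurable (ξ n))
    (hξ₀ : ∀ n ω, 0 ≤ ξ n ω) (hξ : ∀ n, ∫⁻ ω, ENNReal.ofReal (F (ξ n ω)) ∂P ≤ 1) :
    ∃ g, MemOrlicz P F g ∧ ∀ᵐ ω ∂P, ∀ n, (1 / 2) ^ n * ξ n ω ≤ g ω := by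
  set S : Ω → ℝ≥0∞ := fun ω => ∑' n, ENNReal.ofReal ((1 / 2) ^ n * F (ξ n ω)) with hS
  have hterm : ∀ n, Measurable fun ω => ENNReal.ofReal ((1 / 2) ^ n * F (ξ n ω)) := fun n =>
    ((h.measurable.comp (hξm n)).const_mul _).ennreal_ofReal
  have hSint : ∫⁻ ω, S ω ∂P < ⊤ := by
    rw [hS, lintegral_tsum fun n => (hterm n).aemeasurable]
    calc ∑' n, ∫⁻ ω, ENNReal.ofReal ((1 / 2) ^ n * F (ξ n ω)) ∂P
        ≤ ∑' n : ℕ, ENNReal.ofReal ((1 / 2) ^ n) := by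
          refine ENNReal.tsum_le_tsum fun n => ?_
          simp_rw [ENNReal.ofReal_mul (by positivity : (0 : ℝ) ≤ (1 / 2) ^ n)]
          rw [lintegral_const_mul' _ _ ENNReal.ofReal_ne_top]
          exact mul_le_of_le_one_right' (hξ n)
      _ < ⊤ := by
          rw [← ENNReal.ofReal_tsum_of_nonneg (fun n => by positivity) summable_geometric_two]
          exact ENNReal.ofReal_lt_top
  have hSfin : ∀ᵐ ω ∂P, S ω < ⊤ := ae_lt_top (Measurable.tsum hterm) hSint.ne
  have hFle : ∀ ω, S ω < ⊤ → ∀ n, ENNReal.ofReal (F ((1 / 2) ^ n * ξ n ω)) ≤ S ω := by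
    intro ω _ n
    refine le_trans (ENNReal.ofReal_le_ofReal ?_) (ENNReal.le_tsum n)
    exact h.map_mul_le (by positivity) (pow_le_one₀ (by norm_num) (by norm_num)) _
  have hbdd : ∀ ω, S ω < ⊤ → BddAbove (range fun n => (1 / 2) ^ n * ξ n ω) := by
    intro ω hω
    refine ⟨(S ω).toReal + c, ?_⟩
    rintro _ ⟨n, rfl⟩
    refine (hc _).trans (add_le_add_left ?_ c)
    exact (ENNReal.ofReal_le_iff_le_toReal hω.ne).1 (hFle ω hω n)
  refine ⟨fun ω => ⨆ n, (1 / 2) ^ n * ξ n ω,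
    ⟨Measurable.iSup fun n => (hξm n).const_mul _, 1 / 2, by norm_num, ?_⟩, ?_⟩
  · refine (lintegral_mono_ae ?_).trans_lt hSint
    filter_upwards [hSfin] with ω hω
    set s := ⨆ n, (1 / 2) ^ n * ξ n ω with hs
    have hs0 : 0 ≤ s := Real.iSup_nonneg fun n => mul_nonneg (by positivity) (hξ₀ n ω)
    rcases hs0.eq_or_lt with hs0 | hs0
    · rw [← hs0]; simp [h.map_zero]
    · obtain ⟨n, hn⟩ := exists_lt_of_lt_ciSup (show 1 / 2 * s < s by linarith)
      refine le_trans (ENNReal.ofReal_le_ofReal (h.mono_abs ?_)) (hFle ω hω n)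
      rw [abs_of_pos (by positivity)]
      exact hn.le.trans (le_abs_self _)
  · filter_upwards [hSfin] with ω hω n
    exact le_ciSup (hbdd ω hω) n

/-- If `E[Φ(l η)] = ∞`, then some element of the unit ball of `L_{Φ*}` pairs with `|η|` to
exactly `1 / l`. -/
theorem IsYoung.exists_lintegral_mul_eq [IsProbabilityMeasure P] {Φ : ℝ → ℝ} (h : IsYoung Φ)
    {η : Ω → ℝ} (hη : Measurable η) {l : ℝ} (hl : 0 < l)
    (htop : ∫⁻ ω, ENNReal.ofReal (Φ (l * η ω)) ∂P = ⊤) :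
    ∃ ξ : Ω → ℝ, Measurable ξ ∧ (∀ ω, 0 ≤ ξ ω) ∧
      ∫⁻ ω, ENNReal.ofReal (conj Φ (ξ ω)) ∂P ≤ 1 ∧
      ∫⁻ ω, ENNReal.ofReal (|η ω| * ξ ω) ∂P = ENNReal.ofReal (1 / l) := by
  have hΦ := h.evenConvex
  have hΨ := h.evenConvex_conj
  have hΦm : Measurable fun ω => Φ (l * η ω) := hΦ.measurable.comp (hη.const_mul l)
  set B : ℕ → Set Ω := fun k => {ω | |η ω| ≤ k} with hB
  have hBm : ∀ k, MeasurableSet (B k) := fun k => measurableSet_le hη.abs measurable_const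
  have hBmono : Monotone B := fun i j hij ω (hω : |η ω| ≤ i) =>
    show |η ω| ≤ j from hω.trans (Nat.cast_le.2 hij)
  have hBU : ⋃ k, B k = univ := by
    refine eq_univ_of_forall fun ω => mem_iUnion.2 ?_
    exact (exists_nat_ge |η ω|)
  obtain ⟨k, hk⟩ : ∃ k, 1 < ∫⁻ ω in B k, ENNReal.ofReal (Φ (l * η ω)) ∂P := by
    have h1 := setLIntegral_iUnion_of_directed (μ := P)
      (fun ω => ENNReal.ofReal (Φ (l * η ω))) hBmono.directed_le
    rw [hBU, setLIntegral_univ, htop] at h1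
    exact lt_iSup_iff.1 (h1 ▸ ENNReal.one_lt_top)
  have hfin : ∫⁻ ω in B k, ENNReal.ofReal (Φ (l * η ω)) ∂P < ⊤ := by
    refine (setLIntegral_mono measurable_const (g := fun _ => ENNReal.ofReal (Φ (l * k)))
      fun ω hω => ENNReal.ofReal_le_ofReal (hΦ.mono_abs ?_)).trans_lt ?_
    · rw [abs_mul, abs_mul]
      exact mul_le_mul_of_nonneg_left ((show |η ω| ≤ k from hω).trans (le_abs_self _))
        (abs_nonneg l)
    · rw [setLIntegral_const]
      exact ENNReal.mul_lt_top ENNReal.ofReal_lt_top (measure_lt_top _ _)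
  set I := ∫⁻ ω in B k, ENNReal.ofReal (Φ (l * η ω)) ∂P with hI
  set c := I.toReal with hc
  have hIc : I = ENNReal.ofReal c := (ENNReal.ofReal_toReal hfin.ne).symm
  have hc1 : 1 < c := by
    rw [hIc, ← ENNReal.ofReal_one, ENNReal.ofReal_lt_ofReal_iff'] at hk
    exact hk.1
  have hc0 : 0 < c := by linarith
  have hq : ∀ ω, 0 ≤ Φ (l * η ω) / (l * |η ω|) := fun ω => by
    have := hΦ.nonneg (l * η ω); positivity
  refine ⟨(B k).indicator fun ω => c⁻¹ * (Φ (l * η ω) / (l * |η ω|)),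
    ((hΦm.div (hη.abs.const_mul l)).const_mul _).indicator (hBm k),
    fun ω => indicator_nonneg (fun ω _ => mul_nonneg (by positivity) (hq ω)) ω, ?_, ?_⟩
  · calc ∫⁻ ω, ENNReal.ofReal (conj Φ
          ((B k).indicator (fun ω => c⁻¹ * (Φ (l * η ω) / (l * |η ω|))) ω)) ∂P
        ≤ ∫⁻ ω, (B k).indicator
            (fun ω => ENNReal.ofReal c⁻¹ * ENNReal.ofReal (Φ (l * η ω))) ω ∂P := by
          refine lintegral_mono fun ω => ?_
          by_cases hω : ω ∈ B k
          · simp only [indicator_of_mem hω]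
            rw [← ENNReal.ofReal_mul (by positivity)]
            refine ENNReal.ofReal_le_ofReal
              ((hΨ.map_mul_le (by positivity) (inv_le_one_of_one_le₀ hc1.le) _).trans ?_)
            refine mul_le_mul_of_nonneg_left ?_ (by positivity)
            by_cases h0 : η ω = 0
            · simp [h0, hΨ.map_zero, hΦ.map_zero]
            · have := h.conj_div_le (x := l * |η ω|) (by positivity)
              rwa [← abs_of_pos hl, ← abs_mul, hΦ.map_abs, abs_mul, abs_of_pos hl] at this
          · simp [indicator_of_notMem hω, hΨ.map_zero]
      _ = ENNReal.ofReal c⁻¹ * I := by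
          rw [lintegral_indicator (hBm k), lintegral_const_mul _ hΦm.ennreal_ofReal]
      _ ≤ 1 := by
          rw [hIc, ← ENNReal.ofReal_mul (by positivity), inv_mul_cancel₀ hc0.ne',
            ENNReal.ofReal_one]
  · calc ∫⁻ ω, ENNReal.ofReal (|η ω| *
          (B k).indicator (fun ω => c⁻¹ * (Φ (l * η ω) / (l * |η ω|))) ω) ∂P
        = ∫⁻ ω, (B k).indicator
            (fun ω => ENNReal.ofReal (c⁻¹ * l⁻¹) * ENNReal.ofReal (Φ (l * η ω))) ω ∂P := by
          refine lintegral_congr fun ω => ?_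
          by_cases hω : ω ∈ B k
          · simp only [indicator_of_mem hω]
            rw [← ENNReal.ofReal_mul (by positivity)]
            congr 1
            by_cases h0 : η ω = 0
            · simp [h0, hΦ.map_zero]
            · have : |η ω| ≠ 0 := abs_ne_zero.2 h0
              field_simp
          · simp [indicator_of_notMem hω]
      _ = ENNReal.ofReal (c⁻¹ * l⁻¹) * I := by
          rw [lintegral_indicator (hBm k), lintegral_const_mul _ hΦm.ennreal_ofReal]
      _ = ENNReal.ofReal (1 / l) := by
          rw [hIc, ← ENNReal.ofReal_mul (by positivity)]
          congr 1
          field_simp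

/-- The Köthe dual of `L_{Φ*}` is contained in `L_Φ`. -/
theorem IsYoung.memOrlicz_of_integrable_mul [IsProbabilityMeasure P] {Φ : ℝ → ℝ} (h : IsYoung Φ)
    {η : Ω → ℝ} (hη : Measurable η)
    (hint : ∀ ξ, MemOrlicz P (conj Φ) ξ → Integrable (fun ω => η ω * ξ ω) P) :
    MemOrlicz P Φ η := by
  by_contra hcon
  have htop : ∀ l : ℝ, 0 < l → ∫⁻ ω, ENNReal.ofReal (Φ (l * η ω)) ∂P = ⊤ := by
    intro l hl
    by_contra hne
    exact hcon ⟨hη, l, hl, lt_top_iff_ne_top.2 hne⟩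
  choose ξ hξm hξ₀ hξ hpair using fun n : ℕ =>
    h.exists_lintegral_mul_eq hη (by positivity : (0 : ℝ) < (1 / 4) ^ n)
      (htop ((1 / 4) ^ n) (by positivity))
  obtain ⟨g, hg, hle⟩ := h.evenConvex_conj.exists_memOrlicz_forall_le (c := Φ 1)
    (fun y => by linarith [h.young_inequality 1 y]) hξm hξ₀ hξ
  have hlow : ∀ n : ℕ, ENNReal.ofReal (2 ^ n) ≤ ∫⁻ ω, ENNReal.ofReal ‖η ω * g ω‖ ∂P := by
    intro n
    calc ENNReal.ofReal (2 ^ n)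
        = ENNReal.ofReal ((1 / 2) ^ n) * ∫⁻ ω, ENNReal.ofReal (|η ω| * ξ n ω) ∂P := by
          rw [hpair, ← ENNReal.ofReal_mul (by positivity)]
          congr 1
          rw [← one_div_pow, ← mul_pow]
          norm_num
      _ = ∫⁻ ω, ENNReal.ofReal ((1 / 2) ^ n * (|η ω| * ξ n ω)) ∂P := by
          simp_rw [ENNReal.ofReal_mul (by positivity : (0 : ℝ) ≤ (1 / 2) ^ n)]
          rw [lintegral_const_mul' _ _ ENNReal.ofReal_ne_top]
      _ ≤ _ := by
          refine lintegral_mono_ae ?_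
          filter_upwards [hle] with ω hω
          refine ENNReal.ofReal_le_ofReal ?_
          rw [Real.norm_eq_abs, abs_mul]
          have := mul_le_mul_of_nonneg_left ((hω n).trans (le_abs_self _)) (abs_nonneg (η ω))
          linarith
  have hfin : ∫⁻ ω, ENNReal.ofReal ‖η ω * g ω‖ ∂P < ⊤ := by
    have := (hint g hg).norm.lintegral_lt_top
    exact this
  have hreal : ∀ n : ℕ, (2 : ℝ) ^ n ≤ (∫⁻ ω, ENNReal.ofReal ‖η ω * g ω‖ ∂P).toReal := fun n =>
    (ENNReal.ofReal_le_iff_le_toReal hfin.ne).1 (hlow n)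
  obtain ⟨n, hn⟩ := pow_unbounded_of_one_lt
    (∫⁻ ω, ENNReal.ofReal ‖η ω * g ω‖ ∂P).toReal (one_lt_two (α := ℝ))
  exact absurd (hreal n) (not_le.2 hn)

end KoetheDual

theorem hasSum_indicator_iUnion {α : Type*} {f : ℕ → Set α}
    (hd : Pairwise (Function.onFun Disjoint f)) (ω : α) :
    HasSum (fun i => (f i).indicator (fun _ => (1 : ℝ)) ω)
      ((⋃ i, f i).indicator (fun _ => (1 : ℝ)) ω) := by
  by_cases hω : ω ∈ ⋃ i, f i
  · obtain ⟨i, hi⟩ := mem_iUnion.1 hω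
    have hz : ∀ j, j ≠ i → (f j).indicator (fun _ => (1 : ℝ)) ω = 0 := fun j hj =>
      indicator_of_notMem (fun hjω => (disjoint_left.1 (hd hj)) hjω hi) _
    convert! hasSum_single i hz using 1
    simp [hω, hi]
  · rw [indicator_of_notMem hω]
    convert! (hasSum_zero : HasSum (fun _ : ℕ => (0 : ℝ)) 0) using 2 with i
    have hi : ω ∉ f i := fun hi => hω (mem_iUnion.2 ⟨i, hi⟩)
    simp [hi]

section Representation

variable {Ω : Type*} [MeasurableSpace Ω] {P : Measure Ω}

/-- Order continuity of a linear functional on an Orlicz space: dominated sequences which converge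
to zero almost everywhere are mapped to null sequences. -/
def OrderCont (P : Measure Ω) (F : ℝ → ℝ) (φ : (Ω → ℝ) →ₗ[ℝ] ℝ) : Prop :=
  ∀ (ζ : ℕ → Ω → ℝ) (g : Ω → ℝ), MemOrlicz P F g → (∀ n, Measurable (ζ n)) →
    (∀ n, ∀ᵐ ω ∂P, |ζ n ω| ≤ |g ω|) → (∀ᵐ ω ∂P, Tendsto (fun n => ζ n ω) atTop (𝓝 0)) →
    Tendsto (fun n => φ (ζ n)) atTop (𝓝 0)

variable {F : ℝ → ℝ} {φ : (Ω → ℝ) →ₗ[ℝ] ℝ}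

theorem OrderCont.tendsto (hφ : OrderCont P F φ) (h : EvenConvex F) {ζ : ℕ → Ω → ℝ}
    {f g : Ω → ℝ} (hg : MemOrlicz P F g) (hζ : ∀ n, Measurable (ζ n)) (hf : Measurable f)
    (hζg : ∀ n, ∀ᵐ ω ∂P, |ζ n ω| ≤ |g ω|)
    (hlim : ∀ᵐ ω ∂P, Tendsto (fun n => ζ n ω) atTop (𝓝 (f ω))) :
    Tendsto (fun n => φ (ζ n)) atTop (𝓝 (φ f)) := by
  have hfg : ∀ᵐ ω ∂P, |f ω| ≤ |g ω| := by
    filter_upwards [ae_all_iff.2 hζg, hlim] with ω h1 h2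
    exact le_of_tendsto h2.abs (Eventually.of_forall h1)
  have h0 := hφ (fun n => ζ n - f) ((2 : ℝ) • g) (hg.const_smul 2 h) (fun n => (hζ n).sub hf)
    (fun n => by
      filter_upwards [hζg n, hfg] with ω h1 h2
      have := abs_sub (ζ n ω) (f ω)
      simp only [Pi.sub_apply, Pi.smul_apply, smul_eq_mul, abs_mul, abs_two]
      linarith)
    (by
      filter_upwards [hlim] with ω hω
      simpa using hω.sub_const (f ω))
  simpa using h0.add_const (φ f)

theorem OrderCont.map_eq_zero [IsProbabilityMeasure P] (hφ : OrderCont P F φ) {f : Ω → ℝ}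
    (hf : Measurable f) (hf0 : ∀ᵐ ω ∂P, f ω = 0) : φ f = 0 := by
  have := hφ (fun _ => f) (fun _ => 0) (EvenConvex.memOrlicz_const F 0) (fun _ => hf)
    (fun _ => by filter_upwards [hf0] with ω hω; simp [hω])
    (by filter_upwards [hf0] with ω hω; simp [hω])
  exact tendsto_nhds_unique tendsto_const_nhds this

/-- The signed measure `B ↦ φ(1_B)` of an order continuous functional. -/
def OrderCont.signedMeasure [IsProbabilityMeasure P] (hφ : OrderCont P F φ) (h : EvenConvex F) :
    SignedMeasure Ω where
  measureOf' B := by classical exact if MeasurableSet B then φ (B.indicator fun _ => 1) else 0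
  empty' := by
    have : ((∅ : Set Ω).indicator fun _ => (1 : ℝ)) = 0 := by simp; rfl
    simp [this]
  not_measurable' B hB := by simp [hB]
  m_iUnion' f hf hd := by
    simp only [hf, MeasurableSet.iUnion hf, if_true]
    simp only [HasSum, SummationFilter.unconditional_filter]
    refine tendsto_of_seq_tendsto fun s hs => ?_
    simp only [Function.comp_def, ← map_sum]
    refine hφ.tendsto h (g := fun _ => 1) (EvenConvex.memOrlicz_const F 1)
      (fun n => by
        simpa only [Finset.sum_fn] using
          Finset.measurable_sum (s n) fun i _ => measurable_const.indicator (hf i))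
      (measurable_const.indicator (MeasurableSet.iUnion hf)) (fun n => ae_of_all _ fun ω => ?_)
      (ae_of_all _ fun ω => ?_)
    · have hn : ∀ i, 0 ≤ (f i).indicator (fun _ => (1 : ℝ)) ω := fun i =>
        indicator_nonneg (fun _ _ => zero_le_one) ω
      rw [Finset.sum_apply, abs_of_nonneg (Finset.sum_nonneg fun i _ => hn i), abs_one]
      refine (sum_le_hasSum _ (fun i _ => hn i) (hasSum_indicator_iUnion hd ω)).trans ?_
      exact indicator_le_self' (fun _ _ => zero_le_one) ω
    · have := hasSum_indicator_iUnion hd ω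
      simp only [HasSum, SummationFilter.unconditional_filter] at this
      simpa [Function.comp_def] using this.comp hs

/-- An order continuous functional on an Orlicz space is given by a density. -/
theorem OrderCont.exists_density [IsProbabilityMeasure P] (hφ : OrderCont P F φ)
    (h : EvenConvex F) :
    ∃ η : Ω → ℝ, Measurable η ∧ ∀ f, MemOrlicz P F f →
      Integrable (fun ω => η ω * f ω) P ∧ φ f = ∫ ω, η ω * f ω ∂P := by
  set v := hφ.signedMeasure h with hv
  have hvB : ∀ B, MeasurableSet B → v B = φ (B.indicator fun _ => 1) := fun B hB => by
    exact if_pos hB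
  have hac : v ≪ᵥ P.toENNRealVectorMeasure := by
    refine VectorMeasure.AbsolutelyContinuous.mk fun B hB hPB => ?_
    rw [Measure.toENNRealVectorMeasure_apply_measurable hB] at hPB
    rw [hvB B hB]
    refine hφ.map_eq_zero (measurable_const.indicator hB) ?_
    filter_upwards [measure_eq_zero_iff_ae_notMem.1 hPB] with ω hω
    exact indicator_of_notMem hω _
  set η := v.rnDeriv P with hη
  have hηm : Measurable η := SignedMeasure.measurable_rnDeriv v P
  have hηi : Integrable η P := SignedMeasure.integrable_rnDeriv v P
  have hind : ∀ B, MeasurableSet B → φ (B.indicator fun _ => 1) = ∫ ω in B, η ω ∂P := by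
    intro B hB
    rw [← hvB B hB, ← withDensityᵥ_apply hηi hB, SignedMeasure.withDensityᵥ_rnDeriv_eq v P hac]
  have hbint : ∀ (g : Ω → ℝ) (C : ℝ), Measurable g → (∀ ω, |g ω| ≤ C) →
      Integrable (fun ω => η ω * g ω) P := fun g C hg hC =>
    hηi.mul_bdd hg.aestronglyMeasurable (ae_of_all _ hC)
  have hsimple : ∀ s : SimpleFunc Ω ℝ, φ s = ∫ ω, η ω * s ω ∂P := by
    intro s
    induction s using SimpleFunc.induction with
    | const c hB =>
      rename_i B
      have : (⇑(SimpleFunc.piecewise B hB (SimpleFunc.const Ω c) (SimpleFunc.const Ω 0)))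
          = c • B.indicator fun _ => (1 : ℝ) := by
        ext ω
        by_cases hω : ω ∈ B <;> simp [hω]
      rw [this, map_smul, hind B hB, ← integral_indicator hB, smul_eq_mul,
        ← integral_const_mul]
      refine integral_congr_ae (ae_of_all _ fun ω => ?_)
      by_cases hω : ω ∈ B <;> simp [hω, mul_comm]
    | @add f g hd hf hg =>
      obtain ⟨Cf, hCf⟩ := f.exists_forall_norm_le
      obtain ⟨Cg, hCg⟩ := g.exists_forall_norm_le
      rw [SimpleFunc.coe_add, map_add, hf, hg,
        ← integral_add (hbint f Cf f.measurable hCf) (hbint g Cg g.measurable hCg)]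
      simp only [Pi.add_apply, mul_add]
  have hbdd : ∀ (g : Ω → ℝ) (C : ℝ), Measurable g → (∀ ω, |g ω| ≤ C) →
      φ g = ∫ ω, η ω * g ω ∂P := by
    intro g C hg hC
    set s := SimpleFunc.approxOn g hg univ 0 (mem_univ 0) with hs
    have hsC : ∀ n ω, |s n ω| ≤ 2 * C := fun n ω => by
      have := SimpleFunc.norm_approxOn_zero_le hg (mem_univ 0) ω n
      simp only [Real.norm_eq_abs] at this
      exact this.trans (by linarith [hC ω])
    have hslim : ∀ ω, Tendsto (fun n => s n ω) atTop (𝓝 (g ω)) := fun ω =>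
      SimpleFunc.tendsto_approxOn hg (mem_univ 0) (by simp)
    have h1 : Tendsto (fun n => φ (s n)) atTop (𝓝 (φ g)) :=
      hφ.tendsto h (g := fun _ => 2 * C) (EvenConvex.memOrlicz_const F _)
        (fun n => (s n).measurable) hg
        (fun n => ae_of_all _ fun ω => (hsC n ω).trans (le_abs_self _))
        (ae_of_all _ hslim)
    have h2 : Tendsto (fun n => ∫ ω, η ω * s n ω ∂P) atTop (𝓝 (∫ ω, η ω * g ω ∂P)) := by
      refine tendsto_integral_of_dominated_convergence (fun ω => |η ω| * (2 * C))
        (fun n => (hηm.mul (s n).measurable).aestronglyMeasurable) (hηi.abs.mul_const _)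
        (fun n => ae_of_all _ fun ω => ?_) (ae_of_all _ fun ω => (hslim ω).const_mul _)
      rw [Real.norm_eq_abs, abs_mul]
      exact mul_le_mul_of_nonneg_left (hsC n ω) (abs_nonneg _)
    simp only [hsimple] at h1
    exact tendsto_nhds_unique h1 h2
  refine ⟨η, hηm, fun f hf => ?_⟩
  set t : ℕ → Ω → ℝ := fun n => {ω | |f ω| ≤ n}.indicator f with ht
  have htm : ∀ n, Measurable (t n) := fun n =>
    hf.1.indicator (measurableSet_le hf.1.abs measurable_const)
  have htf : ∀ n ω, |t n ω| ≤ |f ω| := fun n ω => norm_indicator_le_norm_self f ω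
  have htn : ∀ n ω, |t n ω| ≤ n := fun n ω => by
    by_cases hω : ω ∈ {ω | |f ω| ≤ n}
    · simp only [ht, indicator_of_mem hω]; exact hω
    · simp [ht, indicator_of_notMem hω]
  have htlim : ∀ ω, Tendsto (fun n => t n ω) atTop (𝓝 (f ω)) := fun ω => by
    obtain ⟨N, hN⟩ := exists_nat_ge |f ω|
    refine tendsto_const_nhds.congr' ?_
    filter_upwards [eventually_ge_atTop N] with n hn
    have hω : ω ∈ {ω | |f ω| ≤ n} := hN.trans (Nat.cast_le.2 hn)
    simp only [ht, indicator_of_mem hω]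
  have hint : Integrable (fun ω => η ω * f ω) P := by
    have hsm : Measurable fun ω => (SignType.sign (η ω) : ℝ) := by
      have : (fun ω => (SignType.sign (η ω) : ℝ)) =
          fun ω => ({ω | 0 < η ω}.indicator (fun _ => (1 : ℝ)) ω)
            - {ω | η ω < 0}.indicator (fun _ => (1 : ℝ)) ω := by
        ext ω
        rcases lt_trichotomy (η ω) 0 with h0 | h0 | h0
        · simp [h0, h0.not_gt]
        · simp [h0]
        · simp [h0, h0.not_gt]
      rw [this]
      exact (measurable_const.indicator (measurableSet_lt measurable_const hηm)).sub
        (measurable_const.indicator (measurableSet_lt hηm measurable_const))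
    have hs1 : ∀ ω, |(SignType.sign (η ω) : ℝ)| ≤ 1 := fun ω => by
      rcases lt_trichotomy (η ω) 0 with h0 | h0 | h0 <;> simp [h0]
    have hsle : ∀ n ω, |(SignType.sign (η ω) : ℝ) * abs (t n ω)| ≤ |t n ω| := fun n ω => by
      rw [abs_mul, abs_abs]
      exact mul_le_of_le_one_left (abs_nonneg _) (hs1 ω)
    have h1 : Tendsto (fun n => φ fun ω => (SignType.sign (η ω) : ℝ) * |t n ω|) atTop
        (𝓝 (φ fun ω => (SignType.sign (η ω) : ℝ) * |f ω|)) :=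
      hφ.tendsto h hf (fun n => hsm.mul (htm n).abs) (hsm.mul hf.1.abs)
        (fun n => ae_of_all _ fun ω => (hsle n ω).trans (htf n ω))
        (ae_of_all _ fun ω => (htlim ω).abs.const_mul _)
    have h2 : ∀ n, (∫⁻ ω, ‖η ω * t n ω‖ₑ ∂P) =
        ENNReal.ofReal (φ fun ω => (SignType.sign (η ω) : ℝ) * |t n ω|) := fun n => by
      rw [hbdd (fun ω => (SignType.sign (η ω) : ℝ) * |t n ω|) n (hsm.mul (htm n).abs)
        fun ω => (hsle n ω).trans (htn n ω),
        ← ofReal_integral_norm_eq_lintegral_enorm (hbint _ n (htm n) (htn n))]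
      congr 1
      refine integral_congr_ae (ae_of_all _ fun ω => ?_)
      simp only [Real.norm_eq_abs, abs_mul]
      rw [← mul_assoc, mul_comm (η ω), sign_mul_self]
    refine ⟨(hηm.mul hf.1).aestronglyMeasurable, ?_⟩
    have h3 : ∀ ω, ‖η ω * f ω‖ₑ = liminf (fun n => ‖η ω * t n ω‖ₑ) atTop := fun ω =>
      ((htlim ω).const_mul _).enorm.liminf_eq.symm
    simp only [HasFiniteIntegral, h3]
    refine (lintegral_liminf_le fun n => (hηm.mul (htm n)).enorm).trans_lt ?_
    have h4 := (ENNReal.tendsto_ofReal h1).liminf_eq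
    simp only [← h2] at h4
    refine lt_of_eq_of_lt h4 ?_
    exact ENNReal.ofReal_lt_top
  refine ⟨hint, ?_⟩
  have h1 : Tendsto (fun n => φ (t n)) atTop (𝓝 (φ f)) :=
    hφ.tendsto h hf htm hf.1 (fun n => ae_of_all _ (htf n)) (ae_of_all _ htlim)
  have h2 : Tendsto (fun n => ∫ ω, η ω * t n ω ∂P) atTop (𝓝 (∫ ω, η ω * f ω ∂P)) := by
    refine tendsto_integral_of_dominated_convergence (fun ω => |η ω * f ω|)
      (fun n => (hηm.mul (htm n)).aestronglyMeasurable) hint.abs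
      (fun n => ae_of_all _ fun ω => ?_) (ae_of_all _ fun ω => (htlim ω).const_mul _)
    rw [Real.norm_eq_abs, abs_mul, abs_mul]
    exact mul_le_mul_of_nonneg_left (htf n ω) (abs_nonneg _)
  have h3 : ∀ n, φ (t n) = ∫ ω, η ω * t n ω ∂P := fun n => hbdd _ n (htm n) (htn n)
  simp only [h3] at h1
  exact tendsto_nhds_unique h1 h2

end Representation

section Tails

/-- The sum of `v` over the set of indices `n` with `s n = true`. -/
def boolSum (v : ℕ → ℝ) (s : ℕ → Bool) : ℝ := ∑' n, if s n then v n else 0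

theorem summable_boolSum {v : ℕ → ℝ} (hv : Summable fun n => |v n|) (s : ℕ → Bool) :
    Summable fun n => if s n then v n else 0 := by
  refine Summable.of_norm_bounded hv fun n => ?_
  by_cases h : s n <;> simp [h]

theorem continuous_boolSum {v : ℕ → ℝ} (hv : Summable fun n => |v n|) :
    Continuous (boolSum v) := by
  refine continuous_tsum (u := fun n => |v n|) (fun n => ?_) hv fun n s => ?_
  · exact (continuous_of_discreteTopology (f := fun b : Bool => if b then v n else 0)).comp
      (continuous_apply n)
  · by_cases h : s n <;> simp [h]

theorem boolSum_sub {v w : ℕ → ℝ} (hv : Summable fun n => |v n|) (hw : Summable fun n => |w n|)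
    (s : ℕ → Bool) : boolSum (v - w) s = boolSum v s - boolSum w s := by
  rw [boolSum, boolSum, boolSum, ← (summable_boolSum hv s).tsum_sub (summable_boolSum hw s)]
  congr with n
  by_cases h : s n <;> simp [h]

/-- The indicator of the tail `[k, ∞)`. -/
def tailSet (k : ℕ) : ℕ → Bool := fun n => decide (k ≤ n)

/-- A Schur type lemma: if all subseries of a sequence `b j` of summable sequences tend to zero,
then the tails of `b j` tend to zero, uniformly in the starting point of the tail. -/
theorem eventually_abs_boolSum_tailSet_le {b : ℕ → ℕ → ℝ} (hb : ∀ j, Summable fun n => |b j n|)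
    (h : ∀ s, Tendsto (fun j => boolSum (b j) s) atTop (𝓝 0)) {ε : ℝ} (hε : 0 < ε) :
    ∃ N, ∀ᶠ j in atTop, ∀ k ≥ N, |boolSum (b j) (tailSet k)| ≤ ε := by
  let C : ℕ → Set (ℕ → Bool) := fun m => {s | ∀ j ≥ m, |boolSum (b j) s| ≤ ε / 2}
  have hC : ∀ m, IsClosed (C m) := fun m => by
    simp only [C, ofPred_forall]
    exact isClosed_iInter fun j => isClosed_iInter fun _ =>
      isClosed_le (continuous_boolSum (hb j)).abs continuous_const
  have hU : ⋃ m, C m = univ := by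
    refine eq_univ_of_forall fun s => mem_iUnion.2 ?_
    have := (tendsto_order.1 (tendsto_zero_iff_abs_tendsto_zero _ |>.1 (h s))).2 (ε / 2) (by simpa)
    obtain ⟨m, hm⟩ := eventually_atTop.1 this
    exact ⟨m, fun j hj => (hm j hj).le⟩
  obtain ⟨m, s, hs⟩ := nonempty_interior_of_iUnion_of_closed hC hU
  obtain ⟨I, t, hIt, hsub⟩ := isOpen_pi_iff.1 isOpen_interior s hs
  obtain ⟨N, hN⟩ : ∃ N, ∀ i ∈ I, i < N := ⟨I.sup id + 1, fun i hi =>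
    Nat.lt_succ_of_le (Finset.le_sup (f := id) hi)⟩
  have hcoord : ∀ n, Tendsto (fun j => b j n) atTop (𝓝 0) := fun n => by
    have := h fun i => decide (i = n)
    simpa [boolSum] using this
  have hfin : Tendsto (fun j => ∑ n ∈ Finset.range N, |b j n|) atTop (𝓝 0) := by
    simpa using tendsto_finsetSum (Finset.range N) fun n _ => (hcoord n).abs
  refine ⟨N, ?_⟩
  filter_upwards [eventually_ge_atTop m, (tendsto_order.1 hfin).2 (ε / 2) (by simpa)]
    with j hj hjf k hk
  let r : ℕ → Bool := fun n => if n < N then s n else decide (k ≤ n)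
  have hr : r ∈ C m := interior_subset (hsub fun i hi => by
    have : r i = s i := if_pos (hN i hi)
    rw [this]; exact (hIt i hi).2)
  have hsplit : boolSum (b j) (tailSet k) =
      boolSum (b j) r - ∑ n ∈ Finset.range N, if s n then b j n else 0 := by
    have h1 : boolSum (b j) r = boolSum (b j) (tailSet k)
        + ∑' n, if n ∈ Finset.range N then (if s n then b j n else 0) else 0 := by
      rw [boolSum, boolSum, ← (summable_boolSum (hb j) _).tsum_add
        (summable_of_ne_finset_zero (s := Finset.range N) fun n hn => if_neg hn)]
      congr with n
      by_cases hn : n < N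
      · have : ¬ k ≤ n := by omega
        simp [r, tailSet, hn, this]
      · simp [r, tailSet, hn]
    rw [h1, tsum_eq_sum (s := Finset.range N) fun n hn => if_neg hn]
    rw [Finset.sum_congr rfl fun n hn => if_pos hn]
    ring
  rw [hsplit]
  have h2 : |∑ n ∈ Finset.range N, if s n then b j n else 0| ≤ ∑ n ∈ Finset.range N, |b j n| := by
    refine (Finset.abs_sum_le_sum_abs _ _).trans (Finset.sum_le_sum fun n _ => ?_)
    by_cases h : s n <;> simp [h]
  have h3 := hr j hj
  have h4 := abs_sub (boolSum (b j) r) (∑ n ∈ Finset.range N, if s n then b j n else 0)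
  linarith

theorem tendsto_boolSum_tailSet {v : ℕ → ℝ} (hv : Summable fun n => |v n|) :
    Tendsto (fun k => boolSum v (tailSet k)) atTop (𝓝 0) := by
  have h0 : boolSum v (fun _ => false) = 0 := by simp [boolSum]
  rw [← h0]
  refine ((continuous_boolSum hv).tendsto _).comp (tendsto_pi_nhds.2 fun n => ?_)
  refine tendsto_const_nhds.congr' ?_
  filter_upwards [eventually_gt_atTop n] with k hk
  simp [tailSet, hk]

theorem tendstoUniformlyOn_boolSum_tailSet {K : Set (ℕ → ℝ)} (hK : IsCompact K)
    (hsum : ∀ v ∈ K, Summable fun n => |v n|)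
    (hcont : ∀ s, ContinuousOn (fun v => boolSum v s) K) :
    TendstoUniformlyOn (fun k v => boolSum v (tailSet k)) (fun _ => 0) atTop K := by
  rw [Metric.tendstoUniformlyOn_iff]
  intro ε hε
  by_contra hcon
  have hfreq : ∀ m, ∃ k ≥ m, ∃ v ∈ K, ε ≤ |boolSum v (tailSet k)| := by
    intro m
    by_contra! hm
    exact hcon (eventually_atTop.2 ⟨m, fun k hk v hv => by simpa using hm k hk v hv⟩)
  choose k hk v hvK hv using hfreq
  obtain ⟨w, hwK, ψ, hψ, hlim⟩ := hK.tendsto_subseq hvK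
  have hlim' : Tendsto (v ∘ ψ) atTop (𝓝[K] w) :=
    tendsto_nhdsWithin_iff.2 ⟨hlim, Eventually.of_forall fun j => hvK _⟩
  obtain ⟨N, hN⟩ := eventually_abs_boolSum_tailSet_le (b := fun j => v (ψ j) - w)
    (fun j => ((hsum _ (hvK _)).add (hsum w hwK)).of_nonneg_of_le (fun _ => abs_nonneg _)
      fun n => abs_sub _ _)
    (fun s => by
      have := ((hcont s w hwK).tendsto.comp hlim').sub_const (boolSum w s)
      simpa [Function.comp_def, boolSum_sub (hsum _ (hvK _)) (hsum w hwK)] using this)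
    (ε := ε / 3) (by positivity)
  have hkψ : Tendsto (fun j => k (ψ j)) atTop atTop :=
    tendsto_atTop_mono (fun j => (hψ.id_le j).trans (hk _)) tendsto_id
  have hw0 := (tendsto_order.1 ((tendsto_boolSum_tailSet (hsum w hwK)).comp hkψ).abs).2 (ε / 3)
    (by simpa using by positivity)
  obtain ⟨j, h1, h2, h3⟩ := (hN.and (hw0.and (hkψ.eventually_ge_atTop N))).exists
  have h4 := h1 _ h3
  rw [boolSum_sub (hsum _ (hvK _)) (hsum w hwK)] at h4
  simp only [Function.comp] at h2
  have h5 := hv (ψ j)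
  have h6 := abs_sub_abs_le_abs_sub (boolSum (v (ψ j)) (tailSet (k (ψ j))))
    (boolSum w (tailSet (k (ψ j))))
  linarith

/-- The tails of a series of functions on a compact space tend to zero uniformly as soon as all
its subseries have continuous sums. -/
theorem tendstoUniformly_boolSum_tailSet {X : Type*} [TopologicalSpace X] [CompactSpace X]
    {a : X → ℕ → ℝ} (hsum : ∀ x, Summable fun n => |a x n|)
    (hcont : ∀ s, Continuous fun x => boolSum (a x) s) :
    TendstoUniformly (fun k x => boolSum (a x) (tailSet k)) (fun _ => 0) atTop := by
  have ha : Continuous a := continuous_pi fun n => by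
    have := hcont fun i => decide (i = n)
    simpa [boolSum] using this
  have hq : IsQuotientMap (rangeFactorization a) :=
    (ha.codRestrict fun x => mem_range_self x).isClosedMap.isQuotientMap
      (ha.codRestrict fun x => mem_range_self x) rangeFactorization_surjective
  have hunif := tendstoUniformlyOn_boolSum_tailSet (K := range a) (isCompact_range ha)
    (by rintro _ ⟨x, rfl⟩; exact hsum x) fun s => by
      rw [continuousOn_iff_continuous_domRestrict, hq.continuous_iff]
      exact hcont s
  rw [Metric.tendstoUniformlyOn_iff] at hunif
  rw [Metric.tendstoUniformly_iff]
  intro ε hε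
  filter_upwards [hunif ε hε] with k hk x
  exact hk (a x) (mem_range_self x)

end Tails

section MackeyConvergence

variable {Ω : Type*} [MeasurableSpace Ω] {P : Measure Ω}

theorem pairing_comm (f g : Ω → ℝ) : pairing P f g = pairing P g f := by
  simp only [pairing, mul_comm]

theorem hasSum_mul_pairing {η D g : Ω → ℝ} {d : ℕ → Ω → ℝ} (hη : Measurable η)
    (hd : ∀ n, Measurable (d n)) (hd0 : ∀ᵐ ω ∂P, ∀ n, 0 ≤ d n ω)
    (hD : ∀ᵐ ω ∂P, HasSum (fun n => d n ω) (D ω)) (hint : Integrable (fun ω => η ω * D ω) P)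
    {c : ℕ → ℝ} (hc : ∀ n, |c n| ≤ 1) (hg : ∀ᵐ ω ∂P, HasSum (fun n => c n * d n ω) (g ω)) :
    HasSum (fun n => c n * pairing P η (d n)) (pairing P η g) := by
  have key := hasSum_integral_of_dominated_convergence (μ := P)
    (F := fun n ω => η ω * (c n * d n ω)) (f := fun ω => η ω * g ω) (fun n ω => |η ω| * d n ω)
    (fun n => (hη.mul ((hd n).const_mul _)).aestronglyMeasurable)
    (fun n => by
      filter_upwards [hd0] with ω h0
      rw [Real.norm_eq_abs, abs_mul, abs_mul, abs_of_nonneg (h0 n)]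
      exact mul_le_mul_of_nonneg_left (mul_le_of_le_one_left (h0 n) (hc n)) (abs_nonneg _))
    (by filter_upwards [hD] with ω h; exact (h.mul_left _).summable)
    (by
      refine hint.abs.congr ?_
      filter_upwards [hD, hd0] with ω h h0
      rw [(h.mul_left _).tsum_eq, abs_mul, abs_of_nonneg (h.nonneg h0)])
    (by filter_upwards [hg] with ω h; exact h.mul_left _)
  have hEq : ∀ n, ∫ ω, η ω * (c n * d n ω) ∂P = c n * pairing P η (d n) := fun n => by
    rw [pairing, ← integral_const_mul]
    congr with ω
    ring
  simp only [hEq] at key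
  exact key

variable [IsProbabilityMeasure P] {Φ : ℝ → ℝ}

theorem IsYoung.tendstoUniformlyOn_pairing (h : IsYoung Φ) {ξ : ℕ → Ω → ℝ} {ξ₀ : Ω → ℝ}
    (hξ : ∀ n, ξ n ∈ Orlicz P (conj Φ)) (hξ₀ : ξ₀ ∈ Orlicz P (conj Φ))
    (hmono : ∀ n, ∀ᵐ ω ∂P, ξ n ω ≤ ξ (n + 1) ω)
    (hlim : ∀ᵐ ω ∂P, Tendsto (fun n => ξ n ω) atTop (𝓝 (ξ₀ ω)))
    {A : Set (Orlicz P Φ)} (hA : @IsCompact _ (weakT P (Orlicz P Φ) (Orlicz P (conj Φ))) A) :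
    TendstoUniformlyOn (fun n (η : Orlicz P Φ) => pairing P (ξ n) η)
      (fun η => pairing P ξ₀ η) atTop A := by
  set d : ℕ → Ω → ℝ := fun n => ξ (n + 1) - ξ n with hddef
  set D : Ω → ℝ := ξ₀ - ξ 0 with hDdef
  have hconj := h.evenConvex_conj
  have hsubmem : ∀ {f g : Ω → ℝ}, f ∈ Orlicz P (conj Φ) → g ∈ Orlicz P (conj Φ) →
      f - g ∈ Orlicz P (conj Φ) := fun hf hg => (orliczSubmodule P hconj).sub_mem hf hg
  have hdmem : ∀ n, d n ∈ Orlicz P (conj Φ) := fun n => hsubmem (hξ _) (hξ _)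
  have hDmem : D ∈ Orlicz P (conj Φ) := hsubmem hξ₀ (hξ 0)
  have hdm : ∀ n, Measurable (d n) := fun n => (hdmem n).1
  have hd0 : ∀ᵐ ω ∂P, ∀ n, 0 ≤ d n ω := by
    filter_upwards [ae_all_iff.2 hmono] with ω hω n
    exact sub_nonneg.2 (hω n)
  have hD : ∀ᵐ ω ∂P, HasSum (fun n => d n ω) (D ω) := by
    filter_upwards [hd0, hlim] with ω h0 hl
    rw [hasSum_iff_tendsto_nat_of_nonneg h0]
    have : ∀ n, ∑ i ∈ Finset.range n, d i ω = ξ n ω - ξ 0 ω := fun n =>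
      Finset.sum_range_sub (fun i => ξ i ω) n
    simp only [this]
    exact hl.sub_const _
  have hint : ∀ η : Orlicz P Φ, Integrable (fun ω => η.1 ω * D ω) P := fun η =>
    h.integrable_mul η.2 hDmem
  let c : (ℕ → Bool) → ℕ → ℝ := fun s n => if s n then 1 else 0
  have hc : ∀ s n, |c s n| ≤ 1 := fun s n => by by_cases hs : s n <;> simp [c, hs]
  have hcmul : ∀ s n (x : ℝ), c s n * x = if s n then x else 0 := fun s n x => by
    by_cases hs : s n <;> simp [c, hs]
  have hsub : ∀ s : ℕ → Bool, ∃ g ∈ Orlicz P (conj Φ), ∀ᵐ ω ∂P,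
      HasSum (fun n => c s n * d n ω) (g ω) := by
    intro s
    have hsummable : ∀ᵐ ω ∂P, Summable fun n => c s n * d n ω := by
      filter_upwards [hd0, hD] with ω h0 hω
      refine Summable.of_norm_bounded hω.summable fun n => ?_
      rw [Real.norm_eq_abs, abs_mul, abs_of_nonneg (h0 n)]
      exact mul_le_of_le_one_left (h0 n) (hc s n)
    obtain ⟨g, hgm, hg⟩ := measurable_limit_of_tendsto_metrizable_ae (μ := P)
      (f := fun N ω => ∑ n ∈ Finset.range N, c s n * d n ω) (L := atTop)
      (fun N => (Finset.measurable_sum _ fun n _ => (hdm n).const_mul _).aemeasurable)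
      (by
        filter_upwards [hsummable] with ω hω
        exact ⟨_, hω.hasSum.tendsto_sum_nat⟩)
    have hgsum : ∀ᵐ ω ∂P, HasSum (fun n => c s n * d n ω) (g ω) := by
      filter_upwards [hsummable, hg] with ω h1 h2
      rw [tendsto_nhds_unique h2 h1.hasSum.tendsto_sum_nat]
      exact h1.hasSum
    refine ⟨g, hconj.memOrlicz_of_abs_le hDmem hgm ?_, hgsum⟩
    filter_upwards [hgsum, hD, hd0] with ω h1 h2 h0
    have hnn : ∀ n, 0 ≤ c s n * d n ω := fun n => by
      rw [hcmul]; split_ifs <;> simp [h0 n]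
    rw [abs_of_nonneg (h1.nonneg hnn), abs_of_nonneg (h2.nonneg h0)]
    exact hasSum_le (fun n => mul_le_of_le_one_left (h0 n) ((le_abs_self _).trans (hc s n))) h1 h2
  let a : Orlicz P Φ → ℕ → ℝ := fun η n => pairing P η (d n)
  have hboolSum : ∀ (η : Orlicz P Φ) (s : ℕ → Bool) (g : Ω → ℝ),
      (∀ᵐ ω ∂P, HasSum (fun n => c s n * d n ω) (g ω)) → boolSum (a η) s = pairing P η g := by
    intro η s g hg
    have := hasSum_mul_pairing η.2.1 hdm hd0 hD (hint η) (hc s) hg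
    simp only [hcmul] at this
    exact this.tsum_eq
  have hsummable : ∀ η : Orlicz P Φ, Summable fun n => |a η n| := by
    intro η
    have h1 := hasSum_mul_pairing (η := fun ω => |η.1 ω|) (g := D) η.2.1.abs hdm hd0 hD
      ((hint η).abs.congr (by
        filter_upwards [hd0, hD] with ω h0 hω
        rw [abs_mul, abs_of_nonneg (hω.nonneg h0)])) (c := fun _ => 1) (by simp) (by simpa using hD)
    simp only [one_mul] at h1
    refine h1.summable.of_nonneg_of_le (fun n => abs_nonneg _) fun n => ?_
    refine (abs_integral_le_integral_abs).trans (le_of_eq (integral_congr_ae ?_))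
    filter_upwards [hd0] with ω h0
    rw [abs_mul, abs_of_nonneg (h0 n)]
  have htail : ∀ (η : Orlicz P Φ) k, boolSum (a η) (tailSet k) = pairing P η (ξ₀ - ξ k) := by
    intro η k
    refine hboolSum η _ _ ?_
    filter_upwards [hD] with ω hω
    have h1 : HasSum (fun n => if n ∈ Finset.range k then d n ω else 0)
        (∑ n ∈ Finset.range k, d n ω) := by
      rw [← Finset.sum_congr rfl fun n hn => if_pos hn]
      exact hasSum_sum_of_ne_finset_zero fun n hn => if_neg hn
    have h2 : ∑ n ∈ Finset.range k, d n ω = ξ k ω - ξ 0 ω :=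
      Finset.sum_range_sub (fun i => ξ i ω) k
    rw [h2] at h1
    convert! hω.sub h1 using 1
    · ext n
      by_cases hn : n < k
      · simp [c, tailSet, hn]
      · simp [c, tailSet, hn, not_lt.1 hn]
    · simp [hDdef]
  let _ : TopologicalSpace (Orlicz P Φ) := weakT P (Orlicz P Φ) (Orlicz P (conj Φ))
  have : CompactSpace A := isCompact_iff_compactSpace.1 hA
  have hunif := tendstoUniformly_boolSum_tailSet (X := A) (a := fun η => a η.1)
    (fun η => hsummable η.1) fun s => by
      obtain ⟨g, hgmem, hg⟩ := hsub s
      have : (fun η : A => boolSum (a η.1) s) = fun η : A => pairing P η.1.1 g := by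
        ext η
        exact hboolSum η.1 s g hg
      rw [this]
      have hw : Continuous fun η : Orlicz P Φ => fun g : Orlicz P (conj Φ) =>
        pairing P (η : Ω → ℝ) (g : Ω → ℝ) := continuous_induced_dom
      exact ((continuous_apply (⟨g, hgmem⟩ : Orlicz P (conj Φ))).comp hw).comp
        continuous_subtype_val
  rw [Metric.tendstoUniformly_iff] at hunif
  rw [Metric.tendstoUniformlyOn_iff]
  intro ε hε
  filter_upwards [hunif ε hε] with k hk η hη
  have h1 := hk ⟨η, hη⟩
  rw [htail] at h1
  have h2 : pairing P η (ξ₀ - ξ k) = pairing P ξ₀ η - pairing P (ξ k) η := by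
    rw [pairing_comm ξ₀, pairing_comm (ξ k), pairing, pairing, pairing,
      ← integral_sub (h.integrable_mul η.2 hξ₀) (h.integrable_mul η.2 (hξ k))]
    simp only [Pi.sub_apply, mul_sub]
  rw [h2, Real.dist_eq, zero_sub, abs_neg] at h1
  rw [Real.dist_eq]
  exact h1

/-- Increasing sequences converge to their pointwise limit in the Mackey topology. -/
theorem IsYoung.tendsto_mackeyT (h : IsYoung Φ) {ξ : ℕ → Ω → ℝ} {ξ₀ : Ω → ℝ}
    (hξ : ∀ n, ξ n ∈ Orlicz P (conj Φ)) (hξ₀ : ξ₀ ∈ Orlicz P (conj Φ))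
    (hmono : ∀ n, ∀ᵐ ω ∂P, ξ n ω ≤ ξ (n + 1) ω)
    (hlim : ∀ᵐ ω ∂P, Tendsto (fun n => ξ n ω) atTop (𝓝 (ξ₀ ω))) :
    Tendsto (fun n => (⟨ξ n, hξ n⟩ : Orlicz P (conj Φ))) atTop
      (@nhds _ (mackeyT P (Orlicz P (conj Φ)) (Orlicz P Φ)) ⟨ξ₀, hξ₀⟩) := by
  rw [mackeyT, nhds_induced, tendsto_comap_iff, UniformOnFun.tendsto_iff_tendstoUniformlyOn]
  intro A hA
  exact h.tendstoUniformlyOn_pairing hξ hξ₀ hmono hlim hA.2.2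

end MackeyConvergence

section HahnBanach

variable {V : Type*} [AddCommGroup V] [Module ℝ V] {W : Set V}

/-- The gauge of an absolutely convex absorbent set is attained by a functional in its polar. -/
theorem exists_linearMap_eq_gauge (hconv : Convex ℝ W) (hbal : Balanced ℝ W)
    (habs : Absorbent ℝ W) (x : V) :
    ∃ φ : V →ₗ[ℝ] ℝ, φ x = gauge W x ∧ ∀ y ∈ W, |φ y| ≤ 1 := by
  by_cases hx : x = 0
  · exact ⟨0, by simp [hx], by simp⟩
  obtain ⟨φ, hφ, hle⟩ := exists_extension_of_le_sublinear
    (LinearPMap.mkSpanSingleton x (gauge W x) hx) (gauge W)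
    (fun c hc y => gauge_smul_of_nonneg hc.le y) (gauge_add_le hconv habs) (by
      rintro ⟨y, hy⟩
      obtain ⟨t, rfl⟩ := Submodule.mem_span_singleton.1 hy
      rw [LinearPMap.mkSpanSingleton'_apply]
      rcases le_total 0 t with ht | ht
      · exact (gauge_smul_of_nonneg ht x).ge
      · exact (mul_nonpos_of_nonpos_of_nonneg ht (gauge_nonneg x)).trans (gauge_nonneg _))
  refine ⟨φ, ?_, fun y hy => abs_le.2 ⟨?_, (hle y).trans (gauge_le_one_of_mem hy)⟩⟩
  · have := hφ ⟨x, Submodule.mem_span_singleton_self x⟩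
    rw [this]
    exact LinearPMap.mkSpanSingleton_apply ℝ ℝ hx (gauge W x)
  · have := (hle (-y)).trans (gauge_le_one_of_mem (hbal.neg_mem_iff.2 hy))
    rw [map_neg] at this
    linarith

theorem inv_smul_mem_of_forall_abs_lt (hconv : Convex ℝ W) (hbal : Balanced ℝ W)
    (habs : Absorbent ℝ W) {x : V} {δ : ℝ}
    (hx : ∀ φ : V →ₗ[ℝ] ℝ, (∀ y ∈ W, |φ y| ≤ 1) → |φ x| < δ) : δ⁻¹ • x ∈ W := by
  obtain ⟨φ, hφx, hφW⟩ := exists_linearMap_eq_gauge hconv hbal habs x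
  have hlt : gauge W x < δ := hφx ▸ (le_abs_self _).trans_lt (hx φ hφW)
  obtain ⟨b, hb0, hbδ, y, hy, rfl⟩ := exists_lt_of_gauge_lt habs hlt
  have hδ : 0 < δ := hb0.trans hbδ
  simp only
  rw [smul_smul]
  refine hbal.smul_mem ?_ hy
  rw [Real.norm_eq_abs, abs_of_pos (by positivity), inv_mul_le_iff₀ hδ, mul_one]
  exact hbδ.le

end HahnBanach

section Utility

variable {Ω : Type*} [MeasurableSpace Ω] {P : Measure Ω} {F : ℝ → ℝ} {u : (Ω → ℝ) → ℝ}

/-- A finite concave function on an Orlicz space which is nonnegative on nonnegative functions and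
vanishes at zero. -/
structure IsUtility (P : Measure Ω) (F : ℝ → ℝ) (u : (Ω → ℝ) → ℝ) : Prop where
  concave : ∀ ξ ∈ Orlicz P F, ∀ η ∈ Orlicz P F, ∀ a b : ℝ, 0 ≤ a → 0 ≤ b → a + b = 1 →
    a * u ξ + b * u η ≤ u (a • ξ + b • η)
  map_zero : u 0 = 0
  nonneg : ∀ ξ ∈ Orlicz P F, 0 ≤ᵐ[P] ξ → 0 ≤ u ξ

/-- Continuity from below. -/
def ContBelow (P : Measure Ω) (F : ℝ → ℝ) (u : (Ω → ℝ) → ℝ) : Prop :=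
  ∀ (ξ : ℕ → Ω → ℝ) (ξ₀ : Ω → ℝ), (∀ n, ξ n ∈ Orlicz P F) → ξ₀ ∈ Orlicz P F →
    (∀ n, ∀ᵐ ω ∂P, ξ n ω ≤ ξ (n + 1) ω) →
    (∀ᵐ ω ∂P, Tendsto (fun n => ξ n ω) atTop (𝓝 (ξ₀ ω))) →
    Tendsto (fun n => u (ξ n)) atTop (𝓝 (u ξ₀))

/-- The functions `f` with `u (-|f|) ≥ -1`. -/
def unitSet (P : Measure Ω) (F : ℝ → ℝ) (u : (Ω → ℝ) → ℝ) : Set (Ω → ℝ) :=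
  {f | f ∈ Orlicz P F ∧ -1 ≤ u fun ω => -|f ω|}

theorem EvenConvex.neg_abs_mem (h : EvenConvex F) {f : Ω → ℝ} (hf : f ∈ Orlicz P F) :
    (fun ω => -|f ω|) ∈ Orlicz P F :=
  h.memOrlicz_of_abs_le hf hf.1.abs.neg (ae_of_all _ fun ω => by simp)

variable [IsProbabilityMeasure P]

theorem IsUtility.le_map_add (hu : IsUtility P F u) (h : EvenConvex F) {ξ ζ : Ω → ℝ}
    (hξ : ξ ∈ Orlicz P F) (hζ : ζ ∈ Orlicz P F) {t : ℝ} (ht : 0 < t) (ht2 : t < 1 / 2) :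
    (1 - 2 * t) * u ξ + t * u ((2 : ℝ) • ξ) + t * u (t⁻¹ • ζ) ≤ u (ξ + ζ) := by
  have h2 : (2 : ℝ) • ξ ∈ orliczSubmodule P h := Submodule.smul_mem _ _ hξ
  have h3 : t⁻¹ • ζ ∈ orliczSubmodule P h := Submodule.smul_mem _ _ hζ
  have h4 : (1 / 2 : ℝ) • (2 : ℝ) • ξ + (1 / 2 : ℝ) • t⁻¹ • ζ ∈ orliczSubmodule P h :=
    Submodule.add_mem _ (Submodule.smul_mem _ _ h2) (Submodule.smul_mem _ _ h3)
  have h5 := hu.concave _ h2 _ h3 (1 / 2) (1 / 2) (by norm_num) (by norm_num) (by norm_num)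
  have h6 := hu.concave _ hξ _ h4 (1 - 2 * t) (2 * t) (by linarith) (by linarith) (by ring)
  have h7 : (1 - 2 * t) • ξ + (2 * t) • ((1 / 2 : ℝ) • (2 : ℝ) • ξ + (1 / 2 : ℝ) • t⁻¹ • ζ)
      = ξ + ζ := by
    ext ω
    simp only [Pi.add_apply, Pi.smul_apply, smul_eq_mul]
    field_simp
    ring
  rw [h7] at h6
  nlinarith [mul_le_mul_of_nonneg_left h5 (by linarith : 0 ≤ 2 * t)]

theorem IsUtility.map_le_sub (hu : IsUtility P F u) (h : EvenConvex F) {ξ ζ : Ω → ℝ}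
    (hξ : ξ ∈ Orlicz P F) (hζ : ζ ∈ Orlicz P F) {t : ℝ} (ht : 0 < t) :
    u (ξ + ζ) ≤ (1 + 2 * t) * u ξ - t * u ((2 : ℝ) • ξ) - t * u (-(t⁻¹ • ζ)) := by
  have h1 : ξ + ζ ∈ orliczSubmodule P h := Submodule.add_mem _ hξ hζ
  have h2 : (2 : ℝ) • ξ ∈ orliczSubmodule P h := Submodule.smul_mem _ _ hξ
  have h3 : -(t⁻¹ • ζ) ∈ orliczSubmodule P h := Submodule.neg_mem _ (Submodule.smul_mem _ _ hζ)
  have h4 : (1 / 2 : ℝ) • (2 : ℝ) • ξ + (1 / 2 : ℝ) • (-(t⁻¹ • ζ)) ∈ orliczSubmodule P h :=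
    Submodule.add_mem _ (Submodule.smul_mem _ _ h2) (Submodule.smul_mem _ _ h3)
  have h5 := hu.concave _ h2 _ h3 (1 / 2) (1 / 2) (by norm_num) (by norm_num) (by norm_num)
  have hpos : 0 < 1 + 2 * t := by linarith
  have h6 := hu.concave _ h1 _ h4 (1 / (1 + 2 * t)) (2 * t / (1 + 2 * t)) (by positivity)
    (by positivity) (by field_simp)
  have h7 : (1 / (1 + 2 * t)) • (ξ + ζ) + (2 * t / (1 + 2 * t)) •
      ((1 / 2 : ℝ) • (2 : ℝ) • ξ + (1 / 2 : ℝ) • (-(t⁻¹ • ζ))) = ξ := by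
    ext ω
    simp only [Pi.add_apply, Pi.smul_apply, Pi.neg_apply, smul_eq_mul]
    field_simp
    ring
  rw [h7] at h6
  have h8 : u (ξ + ζ) + 2 * t * u ((1 / 2 : ℝ) • (2 : ℝ) • ξ + (1 / 2 : ℝ) • (-(t⁻¹ • ζ)))
      ≤ (1 + 2 * t) * u ξ := by
    have := mul_le_mul_of_nonneg_left h6 hpos.le
    refine le_of_eq_of_le ?_ this
    field_simp
  nlinarith [mul_le_mul_of_nonneg_left h5 (by linarith : 0 ≤ 2 * t)]

theorem IsUtility.mono (hu : IsUtility P F u) (h : EvenConvex F) {ξ ξ' : Ω → ℝ}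
    (hξ : ξ ∈ Orlicz P F) (hξ' : ξ' ∈ Orlicz P F) (hle : ∀ᵐ ω ∂P, ξ ω ≤ ξ' ω) : u ξ ≤ u ξ' := by
  have hζ : ξ' - ξ ∈ orliczSubmodule P h := Submodule.sub_mem _ hξ' hξ
  have hlim : Tendsto (fun t : ℝ => (1 - 2 * t) * u ξ + t * u ((2 : ℝ) • ξ)) (𝓝[>] 0)
      (𝓝 (u ξ)) := by
    have : Continuous fun t : ℝ => (1 - 2 * t) * u ξ + t * u ((2 : ℝ) • ξ) := by fun_prop
    simpa using (this.tendsto 0).mono_left nhdsWithin_le_nhds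
  refine le_of_tendsto hlim ?_
  filter_upwards [Ioo_mem_nhdsGT (by norm_num : (0 : ℝ) < 1 / 2)] with t ht
  have h1 := hu.le_map_add h hξ hζ ht.1 ht.2
  rw [add_sub_cancel] at h1
  have h2 : 0 ≤ u (t⁻¹ • (ξ' - ξ)) := by
    refine hu.nonneg _ ((orliczSubmodule P h).smul_mem _ hζ) ?_
    filter_upwards [hle] with ω hω
    exact mul_nonneg (inv_nonneg.2 ht.1.le) (sub_nonneg.2 hω)
  have h3 := mul_nonneg ht.1.le h2
  linarith

theorem IsUtility.unitSet_solid (hu : IsUtility P F u) (h : EvenConvex F) {f g : Ω → ℝ}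
    (hf : f ∈ unitSet P F u) (hg : g ∈ Orlicz P F) (hgf : ∀ᵐ ω ∂P, |g ω| ≤ |f ω|) :
    g ∈ unitSet P F u := by
  refine ⟨hg, hf.2.trans (hu.mono h (h.neg_abs_mem hf.1) (h.neg_abs_mem hg) ?_)⟩
  filter_upwards [hgf] with ω hω
  exact neg_le_neg hω

theorem IsUtility.convex_unitSet (hu : IsUtility P F u) (h : EvenConvex F) :
    Convex ℝ (unitSet P F u) := by
  intro f hf g hg a b ha hb hab
  have hmem : a • f + b • g ∈ orliczSubmodule P h :=
    Submodule.add_mem _ (Submodule.smul_mem _ _ hf.1) (Submodule.smul_mem _ _ hg.1)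
  refine ⟨hmem, ?_⟩
  have hf' : (fun ω => -|f ω|) ∈ orliczSubmodule P h := h.neg_abs_mem hf.1
  have hg' : (fun ω => -|g ω|) ∈ orliczSubmodule P h := h.neg_abs_mem hg.1
  have h1 := hu.concave _ hf' _ hg' a b ha hb hab
  have h2 := hu.mono h (Submodule.add_mem _ (Submodule.smul_mem _ a hf')
    (Submodule.smul_mem _ b hg')) (h.neg_abs_mem hmem) (ae_of_all _ fun ω => by
      have := abs_add_le (a * f ω) (b * g ω)
      rw [abs_mul, abs_mul, abs_of_nonneg ha, abs_of_nonneg hb] at this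
      simp only [Pi.add_apply, Pi.smul_apply, smul_eq_mul]
      linarith)
  have h3 := mul_le_mul_of_nonneg_left hf.2 ha
  have h4 := mul_le_mul_of_nonneg_left hg.2 hb
  linarith

theorem IsUtility.balanced_unitSet (hu : IsUtility P F u) (h : EvenConvex F) :
    Balanced ℝ (unitSet P F u) := by
  rw [balanced_iff_smul_mem]
  intro a ha f hf
  refine hu.unitSet_solid h hf ((orliczSubmodule P h).smul_mem a hf.1) (ae_of_all _ fun ω => ?_)
  rw [Pi.smul_apply, smul_eq_mul, abs_mul]
  exact mul_le_of_le_one_left (abs_nonneg _) ha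

theorem IsUtility.exists_inv_smul_mem (hu : IsUtility P F u)
    (h : EvenConvex F) {f : Ω → ℝ} (hf : f ∈ Orlicz P F) :
    ∃ M : ℝ, 0 < M ∧ M⁻¹ • f ∈ unitSet P F u := by
  set c := u fun ω => -|f ω| with hc
  have hM : (1 : ℝ) ≤ max 1 (-c) := le_max_left _ _
  have hM0 : 0 < max 1 (-c) := by linarith
  refine ⟨max 1 (-c), hM0, (orliczSubmodule P h).smul_mem _ hf, ?_⟩
  have hM1 : (max 1 (-c))⁻¹ ≤ 1 := inv_le_one_of_one_le₀ hM
  have h1 := hu.concave _ (h.neg_abs_mem hf) 0 (orliczSubmodule P h).zero_mem (max 1 (-c))⁻¹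
    (1 - (max 1 (-c))⁻¹) (inv_nonneg.2 hM0.le) (by linarith) (by ring)
  rw [hu.map_zero, mul_zero, add_zero, smul_zero, add_zero, ← hc] at h1
  have h2 : (fun ω => -|((max 1 (-c))⁻¹ • f) ω|) = (max 1 (-c))⁻¹ • fun ω => -|f ω| := by
    ext ω
    simp only [Pi.smul_apply, smul_eq_mul, abs_mul, abs_of_pos (inv_pos.2 hM0)]
    ring
  rw [h2]
  refine le_trans ?_ h1
  rw [inv_mul_eq_div, le_div_iff₀ hM0]
  linarith [le_max_right 1 (-c)]

theorem ContBelow.eventually_smul_mem (hb : ContBelow P F u)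
    (hu : IsUtility P F u) (h : EvenConvex F) {ζ : ℕ → Ω → ℝ} {g : Ω → ℝ} (hg : g ∈ Orlicz P F)
    (hζ : ∀ n, Measurable (ζ n)) (hζg : ∀ n, ∀ᵐ ω ∂P, |ζ n ω| ≤ |g ω|)
    (hlim : ∀ᵐ ω ∂P, Tendsto (fun n => ζ n ω) atTop (𝓝 0)) (c : ℝ) :
    ∀ᶠ n in atTop, c • ζ n ∈ unitSet P F u := by
  set s : ℕ → Ω → ℝ := fun n ω => ⨆ k, |ζ (n + k) ω| with hs
  have hsm : ∀ n, Measurable (s n) := fun n => Measurable.iSup fun k => (hζ _).abs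
  have hae : ∀ᵐ ω ∂P, ∀ n, |ζ n ω| ≤ |g ω| := ae_all_iff.2 hζg
  have hbdd : ∀ ω, (∀ n, |ζ n ω| ≤ |g ω|) → ∀ n, BddAbove (range fun k => |ζ (n + k) ω|) :=
    fun ω hω n => ⟨|g ω|, by rintro _ ⟨k, rfl⟩; exact hω _⟩
  have hs0 : ∀ n ω, 0 ≤ s n ω := fun n ω => Real.iSup_nonneg fun k => abs_nonneg _
  have hsg : ∀ n, ∀ᵐ ω ∂P, |s n ω| ≤ |g ω| := fun n => by
    filter_upwards [hae] with ω hω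
    rw [abs_of_nonneg (hs0 n ω)]
    exact ciSup_le fun k => hω _
  have hsmem : ∀ n, s n ∈ Orlicz P F := fun n => h.memOrlicz_of_abs_le hg (hsm n) (hsg n)
  have hζs : ∀ n, ∀ᵐ ω ∂P, |ζ n ω| ≤ s n ω := fun n => by
    filter_upwards [hae] with ω hω
    exact le_ciSup (hbdd ω hω n) 0
  have hsanti : ∀ n, ∀ᵐ ω ∂P, s (n + 1) ω ≤ s n ω := fun n => by
    filter_upwards [hae] with ω hω
    refine ciSup_le fun k => ?_
    have := le_ciSup (hbdd ω hω n) (1 + k)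
    rwa [← add_assoc] at this
  have hslim : ∀ᵐ ω ∂P, Tendsto (fun n => s n ω) atTop (𝓝 0) := by
    filter_upwards [hlim] with ω hω
    rw [Metric.tendsto_atTop] at hω ⊢
    intro ε hε
    obtain ⟨N, hN⟩ := hω (ε / 2) (by positivity)
    refine ⟨N, fun n hn => ?_⟩
    rw [Real.dist_eq, sub_zero, abs_of_nonneg (hs0 n ω)]
    refine lt_of_le_of_lt (ciSup_le fun k => ?_) (half_lt_self hε)
    have := hN (n + k) (by omega)
    rw [Real.dist_eq, sub_zero] at this
    exact this.le
  have hsmul : ∀ n, -(|c| • s n) ∈ orliczSubmodule P h := fun n =>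
    Submodule.neg_mem _ (Submodule.smul_mem _ _ (hsmem n))
  have hu0 := hb (fun n => -(|c| • s n)) 0 hsmul (orliczSubmodule P h).zero_mem
    (fun n => by
      filter_upwards [hsanti n] with ω hω
      exact neg_le_neg (mul_le_mul_of_nonneg_left hω (abs_nonneg c)))
    (by
      filter_upwards [hslim] with ω hω
      simpa using (hω.const_mul |c|).neg)
  rw [hu.map_zero] at hu0
  filter_upwards [(tendsto_order.1 hu0).1 (-1) (by norm_num)] with n hn
  have hmem : ζ n ∈ orliczSubmodule P h := h.memOrlicz_of_abs_le hg (hζ n) (hζg n)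
  have hcmem : c • ζ n ∈ orliczSubmodule P h := Submodule.smul_mem _ _ hmem
  refine ⟨hcmem, hn.le.trans (hu.mono h (hsmul n) (h.neg_abs_mem hcmem) ?_)⟩
  filter_upwards [hζs n] with ω hω
  simp only [Pi.neg_apply, Pi.smul_apply, smul_eq_mul, abs_mul]
  exact neg_le_neg (mul_le_mul_of_nonneg_left hω (abs_nonneg c))

theorem ContBelow.orderCont (hb : ContBelow P F u)
    (hu : IsUtility P F u) (h : EvenConvex F) {φ : (Ω → ℝ) →ₗ[ℝ] ℝ}
    (hφ : ∀ f ∈ unitSet P F u, |φ f| ≤ 1) : OrderCont P F φ := by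
  intro ζ g hg hζ hζg hlim
  rw [Metric.tendsto_atTop']
  intro ε hε
  have h1 := hb.eventually_smul_mem hu h hg hζ hζg hlim (2 / ε)
  obtain ⟨N, hN⟩ := eventually_atTop.1 h1
  refine ⟨N, fun n hn => ?_⟩
  have h2 := hφ _ (hN n hn.le)
  rw [map_smul, smul_eq_mul, abs_mul, abs_of_pos (by positivity), div_mul_eq_mul_div,
    div_le_one hε] at h2
  rw [Real.dist_eq, sub_zero]
  linarith [abs_nonneg (φ (ζ n))]

end Utility

section Polar

variable {Ω : Type*} [MeasurableSpace Ω] {P : Measure Ω}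

/-- The polar of `unitSet P (conj Φ) u` in the Orlicz space `L_Φ`. -/
def unitPolar (P : Measure Ω) (Φ : ℝ → ℝ) (u : (Ω → ℝ) → ℝ) : Set (Orlicz P Φ) :=
  {η | ∀ f ∈ unitSet P (conj Φ) u, |pairing P η f| ≤ 1}

theorem pairing_smul_left (c : ℝ) (η f : Ω → ℝ) :
    pairing P (c • η) f = c * pairing P η f := by
  simp only [pairing, Pi.smul_apply, smul_eq_mul, mul_assoc, integral_const_mul]

theorem pairing_smul_right (c : ℝ) (η f : Ω → ℝ) :
    pairing P η (c • f) = c * pairing P η f := by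
  rw [pairing_comm, pairing_smul_left, pairing_comm]

variable {Φ : ℝ → ℝ} {u : (Ω → ℝ) → ℝ}

theorem IsYoung.pairing_add_left (hΦ : IsYoung Φ) {η η' f : Ω → ℝ} (hη : η ∈ Orlicz P Φ)
    (hη' : η' ∈ Orlicz P Φ) (hf : f ∈ Orlicz P (conj Φ)) :
    pairing P (η + η') f = pairing P η f + pairing P η' f := by
  rw [pairing, pairing, pairing,
    ← integral_add (hΦ.integrable_mul hη hf) (hΦ.integrable_mul hη' hf)]
  simp only [Pi.add_apply, add_mul]

theorem IsYoung.pairing_add_right (hΦ : IsYoung Φ) {η f g : Ω → ℝ} (hη : η ∈ Orlicz P Φ)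
    (hf : f ∈ Orlicz P (conj Φ)) (hg : g ∈ Orlicz P (conj Φ)) :
    pairing P η (f + g) = pairing P η f + pairing P η g := by
  rw [pairing, pairing, pairing,
    ← integral_add (hΦ.integrable_mul hη hf) (hΦ.integrable_mul hη hg)]
  simp only [Pi.add_apply, mul_add]

variable [IsProbabilityMeasure P]

/-- Functionals in the polar of `unitSet` are represented by elements of `L_Φ`. -/
theorem IsYoung.exists_mem_unitPolar (hΦ : IsYoung Φ) (hu : IsUtility P (conj Φ) u)
    (hb : ContBelow P (conj Φ) u) (ψ : orliczSubmodule P hΦ.evenConvex_conj →ₗ[ℝ] ℝ)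
    (hψ : ∀ f : orliczSubmodule P hΦ.evenConvex_conj, f.1 ∈ unitSet P (conj Φ) u → |ψ f| ≤ 1) :
    ∃ η ∈ unitPolar P Φ u, ∀ f, ψ f = pairing P (η : Ω → ℝ) f := by
  obtain ⟨φ, hφ⟩ := ψ.exists_extend
  have hφψ : ∀ f, φ f.1 = ψ f := fun f => LinearMap.congr_fun hφ f
  have hoc := hb.orderCont hu hΦ.evenConvex_conj (φ := φ) fun f hf => by
    have := hψ ⟨f, hf.1⟩ hf
    rwa [← hφψ] at this
  obtain ⟨η, hηm, hη⟩ := hoc.exists_density hΦ.evenConvex_conj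
  have hηmem : η ∈ Orlicz P Φ := hΦ.memOrlicz_of_integrable_mul hηm fun ξ hξ => (hη ξ hξ).1
  have hrep : ∀ f, ψ f = pairing P η f := fun f => by
    rw [← hφψ, (hη f.1 f.2).2, pairing]
  refine ⟨⟨η, hηmem⟩, fun f hf => ?_, hrep⟩
  have := hψ ⟨f, hf.1⟩ hf
  rwa [hrep] at this

theorem IsYoung.isCompact_unitPolar (hΦ : IsYoung Φ) (hu : IsUtility P (conj Φ) u)
    (hb : ContBelow P (conj Φ) u) :
    @IsCompact _ (weakT P (Orlicz P Φ) (Orlicz P (conj Φ))) (unitPolar P Φ u) := by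
  let _ : TopologicalSpace (Orlicz P Φ) := weakT P (Orlicz P Φ) (Orlicz P (conj Φ))
  have hind : IsInducing fun η : Orlicz P Φ => fun f : Orlicz P (conj Φ) =>
    pairing P (η : Ω → ℝ) (f : Ω → ℝ) := ⟨rfl⟩
  have hadd : ∀ f g : Orlicz P (conj Φ), f.1 + g.1 ∈ Orlicz P (conj Φ) := fun f g =>
    (orliczSubmodule P hΦ.evenConvex_conj).add_mem f.2 g.2
  have hsmul : ∀ (c : ℝ) (f : Orlicz P (conj Φ)), c • f.1 ∈ Orlicz P (conj Φ) := fun c f =>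
    (orliczSubmodule P hΦ.evenConvex_conj).smul_mem c f.2
  rw [hind.isCompact_iff]
  choose M hM0 hM using fun f : Orlicz P (conj Φ) =>
    hu.exists_inv_smul_mem hΦ.evenConvex_conj f.2
  let S : Set (Orlicz P (conj Φ) → ℝ) :=
    {p | (∀ f g, p ⟨f.1 + g.1, hadd f g⟩ = p f + p g) ∧
      (∀ c f, p ⟨c • f.1, hsmul c f⟩ = c * p f) ∧
      ∀ f : Orlicz P (conj Φ), f.1 ∈ unitSet P (conj Φ) u → |p f| ≤ 1}
  have hS : (fun η : Orlicz P Φ => fun f : Orlicz P (conj Φ) =>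
      pairing P (η : Ω → ℝ) (f : Ω → ℝ)) '' unitPolar P Φ u = S := by
    ext p
    constructor
    · rintro ⟨η, hη, rfl⟩
      exact ⟨fun f g => hΦ.pairing_add_right η.2 f.2 g.2, fun c f => pairing_smul_right c _ _,
        fun f hf => hη f.1 hf⟩
    · rintro ⟨hpa, hps, hpW⟩
      let ψ : orliczSubmodule P hΦ.evenConvex_conj →ₗ[ℝ] ℝ :=
        { toFun := fun f => p ⟨f.1, f.2⟩
          map_add' := fun f g => hpa ⟨f.1, f.2⟩ ⟨g.1, g.2⟩
          map_smul' := fun c f => hps c ⟨f.1, f.2⟩ }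
      obtain ⟨η, hη, hrep⟩ := hΦ.exists_mem_unitPolar hu hb ψ fun f hf => hpW ⟨f.1, f.2⟩ hf
      exact ⟨η, hη, funext fun f => (hrep ⟨f.1, f.2⟩).symm⟩
  rw [hS]
  have hclosed : IsClosed S := by
    refine IsClosed.and ?_ (IsClosed.and ?_ ?_)
    · simp only [ofPred_forall]
      exact isClosed_iInter fun f => isClosed_iInter fun g =>
        isClosed_eq (by fun_prop) (by fun_prop)
    · simp only [ofPred_forall]
      exact isClosed_iInter fun c => isClosed_iInter fun f =>
        isClosed_eq (by fun_prop) (by fun_prop)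
    · simp only [ofPred_forall]
      exact isClosed_iInter fun f => isClosed_iInter fun _ =>
        isClosed_le (by fun_prop) (by fun_prop)
  refine IsCompact.of_isClosed_subset
    (isCompact_univ_pi fun f : Orlicz P (conj Φ) => isCompact_Icc (a := -M f) (b := M f)) hclosed ?_
  rintro p ⟨-, hps, hpW⟩ f -
  have h1 := hpW ⟨(M f)⁻¹ • f.1, hsmul _ f⟩ (hM f)
  rw [hps, abs_mul, abs_of_pos (inv_pos.2 (hM0 f)), inv_mul_le_iff₀ (hM0 f), mul_one] at h1
  exact abs_le.1 h1

theorem IsYoung.unitPolar_mem_dualSets (hΦ : IsYoung Φ) (hu : IsUtility P (conj Φ) u)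
    (hb : ContBelow P (conj Φ) u) :
    unitPolar P Φ u ∈ dualSets P (Orlicz P (conj Φ)) (Orlicz P Φ) := by
  refine ⟨?_, ?_, hΦ.isCompact_unitPolar hu hb⟩
  · rintro _ ⟨η, hη, rfl⟩ _ ⟨η', hη', rfl⟩ a b ha hb hab
    have ha' : a • η.1 ∈ orliczSubmodule P hΦ.evenConvex := Submodule.smul_mem _ _ η.2
    have hb' : b • η'.1 ∈ orliczSubmodule P hΦ.evenConvex := Submodule.smul_mem _ _ η'.2
    refine ⟨⟨a • η.1 + b • η'.1, Submodule.add_mem _ ha' hb'⟩, fun f hf => ?_, rfl⟩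
    rw [hΦ.pairing_add_left ha' hb' hf.1, pairing_smul_left, pairing_smul_left]
    refine (abs_add_le _ _).trans ?_
    rw [abs_mul, abs_mul, abs_of_nonneg ha, abs_of_nonneg hb]
    have h1 := mul_le_mul_of_nonneg_left (hη f hf) ha
    have h2 := mul_le_mul_of_nonneg_left (hη' f hf) hb
    linarith
  · rw [balanced_iff_smul_mem]
    rintro a ha _ ⟨η, hη, rfl⟩
    refine ⟨⟨a • η.1, (orliczSubmodule P hΦ.evenConvex).smul_mem a η.2⟩, fun f hf => ?_, rfl⟩
    rw [pairing_smul_left, abs_mul]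
    exact mul_le_one₀ ha (abs_nonneg _) (hη f hf)

/-- Mackey neighbourhoods are controlled by `unitSet`. -/
theorem IsYoung.eventually_inv_smul_sub_mem (hΦ : IsYoung Φ) (hu : IsUtility P (conj Φ) u)
    (hb : ContBelow P (conj Φ) u) (ξ₀ : Orlicz P (conj Φ)) {δ : ℝ} (hδ : 0 < δ) :
    ∀ᶠ ξ : Orlicz P (conj Φ) in @nhds _ (mackeyT P (Orlicz P (conj Φ)) (Orlicz P Φ)) ξ₀,
      δ⁻¹ • ((ξ : Ω → ℝ) - ξ₀) ∈ unitSet P (conj Φ) u := by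
  have h := hΦ.evenConvex_conj
  let _ : TopologicalSpace (Orlicz P (conj Φ)) := mackeyT P (Orlicz P (conj Φ)) (Orlicz P Φ)
  have hcont : Continuous fun ξ : Orlicz P (conj Φ) =>
      UniformOnFun.ofFun (dualSets P (Orlicz P (conj Φ)) (Orlicz P Φ))
        (fun η : Orlicz P Φ => pairing P (ξ : Ω → ℝ) (η : Ω → ℝ)) := continuous_induced_dom
  have hunif := UniformOnFun.tendsto_iff_tendstoUniformlyOn.1 (hcont.tendsto ξ₀) _
    (hΦ.unitPolar_mem_dualSets hu hb)
  rw [Metric.tendstoUniformlyOn_iff] at hunif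
  filter_upwards [hunif δ hδ] with ξ hξ
  let L := orliczSubmodule P h
  let ζ : L := ⟨ξ.1 - ξ₀.1, L.sub_mem ξ.2 ξ₀.2⟩
  have hbal : Balanced ℝ (L.subtype ⁻¹' unitSet P (conj Φ) u) := by
    rw [balanced_iff_smul_mem]
    exact fun a ha f hf => (hu.balanced_unitSet h).smul_mem ha hf
  have hmem : δ⁻¹ • ζ ∈ L.subtype ⁻¹' unitSet P (conj Φ) u := by
    refine inv_smul_mem_of_forall_abs_lt ((hu.convex_unitSet h).linear_preimage L.subtype) hbal
      ?_ fun ψ hψ => ?_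
    · intro f
      obtain ⟨M, hM0, hM⟩ := hu.exists_inv_smul_mem h f.2
      refine absorbs_iff_norm.2 ⟨M, fun c hc => singleton_subset_iff.2 ?_⟩
      have hc0 : 0 < ‖c‖ := hM0.trans_le hc
      rw [mem_smul_set_iff_inv_smul_mem₀ (norm_pos_iff.1 hc0)]
      have hsm : c⁻¹ • f = (c⁻¹ * M) • M⁻¹ • f := by
        rw [smul_smul, mul_inv_cancel_right₀ hM0.ne']
      rw [hsm]
      refine hbal.smul_mem ?_ hM
      rw [norm_mul, norm_inv, Real.norm_of_nonneg hM0.le, inv_mul_le_iff₀ hc0, mul_one]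
      exact hc
    · obtain ⟨η, hη, hrep⟩ := hΦ.exists_mem_unitPolar hu hb ψ hψ
      have h1 := hξ η hη
      have h2 : pairing P (η : Ω → ℝ) ξ = pairing P (η : Ω → ℝ) ζ.1
          + pairing P (η : Ω → ℝ) ξ₀ := by
        rw [← hΦ.pairing_add_right η.2 ζ.2 ξ₀.2]
        simp [ζ]
      rw [Real.dist_eq] at h1
      simp only [UniformOnFun.toFun_ofFun, Function.comp] at h1
      rw [pairing_comm, pairing_comm ξ.1, h2, sub_add_cancel_right, abs_neg] at h1
      rwa [hrep]
  exact hmem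

theorem IsYoung.continuous_of_contBelow (hΦ : IsYoung Φ) (hu : IsUtility P (conj Φ) u)
    (hb : ContBelow P (conj Φ) u) :
    @Continuous _ _ (mackeyT P (Orlicz P (conj Φ)) (Orlicz P Φ)) _
      fun ξ : Orlicz P (conj Φ) => u ξ.1 := by
  have h := hΦ.evenConvex_conj
  let _ : TopologicalSpace (Orlicz P (conj Φ)) := mackeyT P (Orlicz P (conj Φ)) (Orlicz P Φ)
  rw [continuous_iff_continuousAt]
  intro ξ₀
  set a := u ξ₀.1 with ha
  set b := u ((2 : ℝ) • ξ₀.1) with hbdef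
  have hbounds : ∀ t : ℝ, 0 < t → t < 1 / 2 → ∀ᶠ ξ : Orlicz P (conj Φ) in 𝓝 ξ₀,
      (1 - 2 * t) * a + t * b - t ≤ u ξ.1 ∧ u ξ.1 ≤ (1 + 2 * t) * a - t * b + t := by
    intro t ht ht2
    filter_upwards [hΦ.eventually_inv_smul_sub_mem hu hb ξ₀ ht] with ξ hξ
    have hζ : ξ.1 - ξ₀.1 ∈ orliczSubmodule P h := Submodule.sub_mem _ ξ.2 ξ₀.2
    have h1 := hu.le_map_add h ξ₀.2 hζ ht ht2
    have h2 := hu.map_le_sub h ξ₀.2 hζ ht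
    rw [add_sub_cancel] at h1 h2
    have h3 : -1 ≤ u (t⁻¹ • (ξ.1 - ξ₀.1)) := hξ.2.trans
      (hu.mono h (h.neg_abs_mem hξ.1) hξ.1 (ae_of_all _ fun ω => neg_abs_le _))
    have h4 : -1 ≤ u (-(t⁻¹ • (ξ.1 - ξ₀.1))) := hξ.2.trans
      (hu.mono h (h.neg_abs_mem hξ.1) ((orliczSubmodule P h).neg_mem hξ.1)
        (ae_of_all _ fun ω => neg_le_neg (le_abs_self _)))
    have h5 := mul_le_mul_of_nonneg_left h3 ht.le
    have h6 := mul_le_mul_of_nonneg_left h4 ht.le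
    constructor <;> linarith
  have hlow : Tendsto (fun t : ℝ => (1 - 2 * t) * a + t * b - t) (𝓝[>] 0) (𝓝 a) := by
    have : Continuous fun t : ℝ => (1 - 2 * t) * a + t * b - t := by fun_prop
    simpa using (this.tendsto 0).mono_left nhdsWithin_le_nhds
  have hupp : Tendsto (fun t : ℝ => (1 + 2 * t) * a - t * b + t) (𝓝[>] 0) (𝓝 a) := by
    have : Continuous fun t : ℝ => (1 + 2 * t) * a - t * b + t := by fun_prop
    simpa using (this.tendsto 0).mono_left nhdsWithin_le_nhds
  have hsmall : ∀ᶠ t : ℝ in 𝓝[>] 0, t ∈ Ioo (0 : ℝ) (1 / 2) :=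
    Ioo_mem_nhdsGT (by norm_num)
  rw [ContinuousAt, tendsto_order]
  constructor
  · intro c hc
    obtain ⟨t, ht1, ht2⟩ := (((tendsto_order.1 hlow).1 c hc).and hsmall).exists
    filter_upwards [hbounds t ht2.1 ht2.2] with ξ hξ
    exact ht1.trans_le hξ.1
  · intro c hc
    obtain ⟨t, ht1, ht2⟩ := (((tendsto_order.1 hupp).2 c hc).and hsmall).exists
    filter_upwards [hbounds t ht2.1 ht2.2] with ξ hξ
    exact hξ.2.trans_lt ht1

end Polar

/-- If `Φ ∈ Δ₂`, a finite-valued monetary utility function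
`u : L_{Φ*} → ℝ` is `τ(L_{Φ*},L_Φ)`-continuous iff it is continuous from
below: `ξ_n ↑ ξ` implies `u(ξ_n) → u(ξ)`. -/
theorem statement19
    {Ω : Type*} [MeasurableSpace Ω] (P : Measure Ω) [IsProbabilityMeasure P]
    (Φ : ℝ → ℝ) (hΦ : IsYoung Φ) (hΔ : Delta2 Φ)
    (u : (Ω → ℝ) → ℝ)
    (hconcave : ∀ ξ ∈ Orlicz P (conj Φ), ∀ η ∈ Orlicz P (conj Φ), ∀ a b : ℝ,
      0 ≤ a → 0 ≤ b → a + b = 1 →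
      a * u ξ + b * u η ≤ u (a • ξ + b • η))
    (hzero : u 0 = 0)
    (hpos : ∀ ξ ∈ Orlicz P (conj Φ), 0 ≤ᵐ[P] ξ → 0 ≤ u ξ)
    (hcash : ∀ ξ ∈ Orlicz P (conj Φ), ∀ a : ℝ, u (fun ω => ξ ω + a) = u ξ + a) :
    (@Continuous _ _ (mackeyT P (Orlicz P (conj Φ)) (Orlicz P Φ)) _
        fun ξ : Orlicz P (conj Φ) => u ξ.1) ↔
      (∀ (ξ : ℕ → Ω → ℝ) (ξ₀ : Ω → ℝ), (∀ n, ξ n ∈ Orlicz P (conj Φ)) →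
        ξ₀ ∈ Orlicz P (conj Φ) →
        (∀ n, ∀ᵐ ω ∂P, ξ n ω ≤ ξ (n + 1) ω) →
        (∀ᵐ ω ∂P, Tendsto (fun n => ξ n ω) atTop (𝓝 (ξ₀ ω))) →
        Tendsto (fun n => u (ξ n)) atTop (𝓝 (u ξ₀))) := by
  have hu : IsUtility P (conj Φ) u := ⟨hconcave, hzero, hpos⟩
  refine ⟨fun hcont ξ ξ₀ hξ hξ₀ hmono hlim => ?_, fun hb => hΦ.continuous_of_contBelow hu hb⟩
  let _ : TopologicalSpace (Orlicz P (conj Φ)) := mackeyT P (Orlicz P (conj Φ)) (Orlicz P Φ)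
  exact (hcont.tendsto ⟨ξ₀, hξ₀⟩).comp (hΦ.tendsto_mackeyT hξ hξ₀ hmono hlim)

end OrliczPaper
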